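/- arXiv:math/0603372 — 4 statements merged into one kernel-verified Lean document; each statement's English description precedes it below -/
import Mathlib

section
/- Let n ≥ 1 and let φ be a translation invariant continuous convex valuation on ℝⁿ. Then there exist unique functions φ₀, φ₁, …, φₙ : 𝒦(ℝⁿ) → ℂ such that each φᵢ is a translation invariant continuous convex valuation that is i-homogeneous (φᵢ(λK) = λⁱ·φᵢ(K) for all λ > 0 and all K ∈ 𝒦(ℝⁿ)), and φ = φ₀ + φ₁ + ⋯ + φₙ. (McMullen's homogeneous decomposition: Val(V) = ⊕_{i=0}^{n} Val_i(V).) -/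
open scoped Pointwise

noncomputable section

/-- Euclidean `n`-space `ℝⁿ`. -/
abbrev Euc (n : ℕ) : Type := EuclideanSpace ℝ (Fin n)

/-- `𝒦(ℝⁿ)`: nonempty convex compact subsets of `ℝⁿ`, equipped with the Hausdorff metric. -/
abbrev CB (n : ℕ) : Type := ConvexBody (Euc n)

/-- `φ` is a convex valuation: `φ(A ∪ B) = φ(A) + φ(B) - φ(A ∩ B)` whenever
`A`, `B` and `A ∪ B` are convex bodies (then `A ∩ B` is one as well). -/
def IsVal {n : ℕ} (φ : CB n → ℂ) : Prop :=
  ∀ A B U I : CB n, (U : Set (Euc n)) = (A : Set (Euc n)) ∪ (B : Set (Euc n)) →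
    (I : Set (Euc n)) = (A : Set (Euc n)) ∩ (B : Set (Euc n)) → φ U = φ A + φ B - φ I

/-- `φ` is translation invariant: `φ(x + K) = φ(K)`. -/
def TransInv {n : ℕ} (φ : CB n → ℂ) : Prop :=
  ∀ (K L : CB n) (x : Euc n), (L : Set (Euc n)) = x +ᵥ (K : Set (Euc n)) → φ L = φ K

/-- A translation invariant continuous (w.r.t. the Hausdorff metric) convex valuation. -/
def GoodVal {n : ℕ} (φ : CB n → ℂ) : Prop := IsVal φ ∧ Continuous φ ∧ TransInv φ

/-- `φ` is `i`-homogeneous: `φ(λ • K) = λ^i • φ(K)` for `λ > 0`. -/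
def Homog {n : ℕ} (i : ℕ) (φ : CB n → ℂ) : Prop :=
  ∀ l : ℝ, 0 < l → ∀ K : CB n, φ (l • K) = (l : ℂ) ^ i * φ K

/-- The extension of `φ` to all subsets of `ℝⁿ` by `0`. -/
def bodyExt {n : ℕ} (φ : CB n → ℂ) (X : Set (Euc n)) : ℂ :=
  open Classical in
  if h : Convex ℝ X ∧ IsCompact X ∧ X.Nonempty then φ ⟨X, h.1, h.2.1, h.2.2⟩ else 0

section Extension

variable {n : ℕ} {φ : CB n → ℂ}

theorem bodyExt_coe (K : CB n) : bodyExt φ (K : Set (Euc n)) = φ K :=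
  dif_pos ⟨K.convex, K.isCompact, K.nonempty⟩

theorem bodyExt_empty : bodyExt φ ∅ = 0 :=
  dif_neg fun h => Set.not_nonempty_empty h.2.2

theorem bodyExt_vadd (hφ : TransInv φ) (K : CB n) (x : Euc n) :
    bodyExt φ (x +ᵥ (K : Set (Euc n))) = φ K := by
  let L : CB n := ⟨x +ᵥ (K : Set (Euc n)), K.convex.vadd x, K.isCompact.vadd x,
    K.nonempty.vadd_set⟩
  exact (bodyExt_coe L).trans (hφ K L x rfl)

theorem bodyExt_union (hφ : IsVal φ) {A B : Set (Euc n)} (hA : IsCompact A) (hB : IsCompact B)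
    (cA : Convex ℝ A) (cB : Convex ℝ B) (cU : Convex ℝ (A ∪ B))
    (hI : A.Nonempty → B.Nonempty → (A ∩ B).Nonempty) :
    bodyExt φ (A ∪ B) = bodyExt φ A + bodyExt φ B - bodyExt φ (A ∩ B) := by
  rcases A.eq_empty_or_nonempty with rfl | nA
  · simp [bodyExt_empty]
  rcases B.eq_empty_or_nonempty with rfl | nB
  · simp [bodyExt_empty]
  have h := hφ ⟨A, cA, hA, nA⟩ ⟨B, cB, hB, nB⟩ ⟨A ∪ B, cU, hA.union hB, nA.inl⟩
    ⟨A ∩ B, cA.inter cB, hA.inter hB, hI nA nB⟩ rfl rfl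
  simpa only [← bodyExt_coe, ConvexBody.coe_mk] using h

variable {E : Type*} [NormedAddCommGroup E] [NormedSpace ℝ E]

theorem exists_eq_and_map_eq {Y : Set E} (hY : Convex ℝ Y) (L : E →L[ℝ] Euc n) (l : E →L[ℝ] ℝ)
    {a : ℝ} {x y : E} (hx : x ∈ Y) (hy : y ∈ Y) (hax : a ≤ l x) (hay : l y ≤ a) (h : L x = L y) :
    ∃ z ∈ Y, l z = a ∧ L z = L x := by
  have hmem : a ∈ Set.Icc (l y) (l x) := ⟨hay, hax⟩
  rw [← segment_eq_Icc (hay.trans hax)] at hmem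
  obtain ⟨s, t, hs, ht, hst, rfl⟩ := hmem
  refine ⟨s • y + t • x, hY hy hx hs ht hst, by simp, ?_⟩
  rw [map_add, map_smul, map_smul, ← h, ← add_smul, hst, one_smul]

/-- Cutting a convex compact set by a hyperplane, upstairs from a linear image. -/
theorem bodyExt_cut (hφ : IsVal φ) (L : E →L[ℝ] Euc n) (l : E →L[ℝ] ℝ) (a : ℝ) {Y : Set E}
    (cY : Convex ℝ Y) (hY : IsCompact Y) :
    bodyExt φ (L '' Y) = bodyExt φ (L '' (Y ∩ {t | a ≤ l t})) +
      bodyExt φ (L '' (Y ∩ {t | l t ≤ a})) - bodyExt φ (L '' (Y ∩ {t | l t = a})) := by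
  have hU : L '' Y = L '' (Y ∩ {t | a ≤ l t}) ∪ L '' (Y ∩ {t | l t ≤ a}) := by
    rw [← Set.image_union, ← Set.inter_union_distrib_left, Set.inter_eq_left.2]
    intro t _
    exact le_total a (l t)
  have hI : L '' (Y ∩ {t | l t = a}) = L '' (Y ∩ {t | a ≤ l t}) ∩ L '' (Y ∩ {t | l t ≤ a}) := by
    ext z
    constructor
    · rintro ⟨t, ⟨ht, rfl⟩, rfl⟩
      exact ⟨⟨t, ⟨ht, le_refl (l t)⟩, rfl⟩, ⟨t, ⟨ht, le_refl (l t)⟩, rfl⟩⟩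
    · rintro ⟨⟨x, ⟨hx, hax⟩, rfl⟩, ⟨y, ⟨hy, hay⟩, hxy⟩⟩
      obtain ⟨z, hz, hza, hzx⟩ := exists_eq_and_map_eq cY L l hx hy hax hay hxy.symm
      exact ⟨z, ⟨hz, hza⟩, hzx⟩
  have cge : Convex ℝ {t | a ≤ l t} := convex_halfSpace_ge l.toLinearMap.isLinear a
  have cle : Convex ℝ {t | l t ≤ a} := convex_halfSpace_le l.toLinearMap.isLinear a
  have kge : IsClosed {t | a ≤ l t} := isClosed_le continuous_const l.continuous
  have kle : IsClosed {t | l t ≤ a} := isClosed_le l.continuous continuous_const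
  rw [hI, hU]
  refine bodyExt_union hφ ((hY.inter_right kge).image L.continuous)
    ((hY.inter_right kle).image L.continuous) ((cY.inter cge).linear_image L.toLinearMap)
    ((cY.inter cle).linear_image L.toLinearMap) ?_ ?_
  · rw [← hU]
    exact cY.linear_image L.toLinearMap
  · rintro ⟨_, x, ⟨hx, hax⟩, rfl⟩ ⟨_, y, ⟨hy, hay⟩, rfl⟩
    rw [← hI]
    obtain ⟨z, hz, hza, -⟩ := exists_eq_and_map_eq (n := 0) cY 0 l hx hy hax hay rfl
    exact ⟨L z, z, ⟨hz, hza⟩, rfl⟩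

end Extension

section Simplex

variable {n : ℕ} {φ : CB n → ℂ} {ι : Type*} [Fintype ι]

theorem sum_powerset_bodyExt_eq_zero (hφ : IsVal φ) (L : (ι → ℝ) →L[ℝ] Euc n)
    {s : Finset ι} (hs : s.Nonempty) : ∀ {Y : Set (ι → ℝ)}, Convex ℝ Y → IsCompact Y →
    (∀ t ∈ Y, (∀ i ∈ s, t i ≤ 1) → ∀ i ∈ s, t i = 1) →
    ∑ S ∈ s.powerset, (-1 : ℂ) ^ S.card * bodyExt φ (L '' (Y ∩ {t | ∀ i ∈ S, 1 ≤ t i})) = 0 := by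
  classical
  have key : ∀ (i : ι) (Y : Set (ι → ℝ)), Convex ℝ Y → IsCompact Y →
      bodyExt φ (L '' Y) - bodyExt φ (L '' (Y ∩ {t | 1 ≤ t i})) =
        bodyExt φ (L '' (Y ∩ {t | t i ≤ 1})) - bodyExt φ (L '' (Y ∩ {t | t i = 1})) := by
    intro i Y cY hY
    have h := bodyExt_cut hφ L (ContinuousLinearMap.proj (R := ℝ) (φ := fun _ : ι => ℝ) i) 1 cY hY
    simp only [ContinuousLinearMap.proj_apply] at h
    rw [h]
    ring
  have cge : ∀ S : Finset ι, Convex ℝ {t : ι → ℝ | ∀ i ∈ S, 1 ≤ t i} := by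
    intro S x hx y hy a b ha hb hab i hi
    have h1 := mul_le_mul_of_nonneg_left (hx i hi) ha
    have h2 := mul_le_mul_of_nonneg_left (hy i hi) hb
    simp only [Pi.add_apply, Pi.smul_apply, smul_eq_mul]
    linarith
  have kge : ∀ S : Finset ι, IsClosed {t : ι → ℝ | ∀ i ∈ S, 1 ≤ t i} := by
    intro S
    simp only [Set.ofPred_forall]
    exact isClosed_iInter fun i => isClosed_iInter fun _ =>
      isClosed_le continuous_const (continuous_apply i)
  induction hs using Finset.Nonempty.cons_induction with
  | singleton i =>
    intro Y cY hY h
    have hk := key i Y cY hY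
    have : Y ∩ {t | t i ≤ 1} = Y ∩ {t | t i = 1} := by
      ext t
      constructor
      · rintro ⟨ht, hti⟩
        exact ⟨ht, h t ht (by simpa using hti) i (by simp)⟩
      · rintro ⟨ht, hti⟩
        exact ⟨ht, le_of_eq hti⟩
    rw [this, sub_self] at hk
    have e : ({i} : Finset ι) = insert i ∅ := rfl
    rw [e, Finset.sum_powerset_insert (Finset.notMem_empty i)]
    simpa [sub_eq_add_neg] using hk
  | cons i s hi hs ih =>
    intro Y cY hY h
    have ih_le := ih (Y := Y ∩ {t | t i ≤ 1})
      (cY.inter (convex_halfSpace_le (LinearMap.proj (R := ℝ) (φ := fun _ : ι => ℝ) i).isLinear 1))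
      (hY.inter_right (isClosed_le (continuous_apply i) continuous_const))
      fun t ht hts j hj => h t ht.1 (Finset.forall_mem_cons hi _ |>.2 ⟨ht.2, hts⟩) j
        (Finset.mem_cons_of_mem hj)
    have ih_eq := ih (Y := Y ∩ {t | t i = 1})
      (cY.inter (convex_hyperplane (LinearMap.proj (R := ℝ) (φ := fun _ : ι => ℝ) i).isLinear 1))
      (hY.inter_right (isClosed_eq (continuous_apply i) continuous_const))
      fun t ht hts j hj => h t ht.1 (Finset.forall_mem_cons hi _ |>.2 ⟨le_of_eq ht.2, hts⟩) j
        (Finset.mem_cons_of_mem hj)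
    rw [Finset.cons_eq_insert, Finset.sum_powerset_insert hi, ← Finset.sum_add_distrib]
    refine Eq.trans ?_ ((congrArg₂ (· - ·) ih_le ih_eq).trans (sub_zero 0))
    rw [← Finset.sum_sub_distrib]
    refine Finset.sum_congr rfl fun S hS => ?_
    have hk := key i _ (cY.inter (cge S)) (hY.inter_right (kge S))
    have hins : Y ∩ {t : ι → ℝ | ∀ j ∈ insert i S, 1 ≤ t j} =
        Y ∩ {t | ∀ j ∈ S, 1 ≤ t j} ∩ {t | 1 ≤ t i} := by
      ext t
      simp only [Finset.forall_mem_insert, Set.mem_inter_iff, Set.mem_ofPred_eq]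
      tauto
    rw [Finset.card_insert_of_notMem fun hiS => hi (Finset.mem_powerset.1 hS hiS), hins,
      Set.inter_right_comm Y {t | t i ≤ 1}, Set.inter_right_comm Y {t | t i = 1}]
    linear_combination (-1 : ℂ) ^ S.card * hk

theorem mem_smul_stdSimplex [Nonempty ι] {c : ℝ} (hc : 0 ≤ c) {t : ι → ℝ} :
    t ∈ c • stdSimplex ℝ ι ↔ (∀ i, 0 ≤ t i) ∧ ∑ i, t i = c := by
  constructor
  · rintro ⟨u, ⟨hu, hu1⟩, rfl⟩
    refine ⟨fun i => mul_nonneg hc (hu i), ?_⟩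
    simp [← Finset.mul_sum, hu1]
  · rintro ⟨ht, hs⟩
    rcases hc.eq_or_lt with rfl | hc
    · have : t = 0 := by
        ext i
        exact (Finset.sum_eq_zero_iff_of_nonneg fun i _ => ht i).1 hs i (Finset.mem_univ i)
      classical
      obtain ⟨i⟩ := ‹Nonempty ι›
      exact ⟨_, single_mem_stdSimplex ℝ i, by simp [this]⟩
    · refine ⟨c⁻¹ • t, ⟨fun i => mul_nonneg (inv_nonneg.2 hc.le) (ht i), ?_⟩,
        smul_inv_smul₀ hc.ne' t⟩
      simp [← Finset.mul_sum, hs, hc.ne']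

theorem smul_stdSimplex_inter (S : Finset ι) {N : ℕ} [Nonempty ι] (hN : S.card ≤ N) :
    (N : ℝ) • stdSimplex ℝ ι ∩ {t | ∀ i ∈ S, 1 ≤ t i} =
      Set.indicator (S : Set ι) (1 : ι → ℝ) +ᵥ ((N - S.card : ℕ) : ℝ) • stdSimplex ℝ ι := by
  classical
  have hsum : ∑ i, Set.indicator (S : Set ι) (1 : ι → ℝ) i = S.card := by
    simp [Set.indicator_apply]
  ext t
  rw [Set.mem_vadd_set_iff_neg_vadd_mem, mem_smul_stdSimplex (Nat.cast_nonneg _), Set.mem_inter_iff,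
    mem_smul_stdSimplex (Nat.cast_nonneg _), Nat.cast_sub hN]
  simp only [vadd_eq_add, Pi.add_apply, Pi.neg_apply, Finset.sum_add_distrib,
    Finset.sum_neg_distrib, hsum, Set.mem_ofPred_eq]
  constructor
  · rintro ⟨⟨h0, hs⟩, h1⟩
    refine ⟨fun i => ?_, by rw [hs]; ring⟩
    by_cases hi : i ∈ S
    · simpa [hi] using h1 i hi
    · simpa [hi] using h0 i
  · rintro ⟨h0, hs⟩
    refine ⟨⟨fun i => ?_, by linarith⟩, fun i hi => ?_⟩
    · have := h0 i
      by_cases hi : i ∈ S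
      · simp [hi] at this
        linarith
      · simpa [hi] using this
    · simpa [hi] using h0 i

theorem sum_powerset_smul_eq_zero (hφ : IsVal φ) (hT : TransInv φ) (L : (ι → ℝ) →L[ℝ] Euc n)
    [Nonempty ι] {P : CB n} (hP : (P : Set (Euc n)) = L '' stdSimplex ℝ ι) {N : ℕ}
    (hN : Fintype.card ι ≤ N) :
    ∑ S ∈ (Finset.univ : Finset ι).powerset,
      (-1 : ℂ) ^ S.card * φ (((N - S.card : ℕ) : ℝ) • P) = 0 := by
  rw [← sum_powerset_bodyExt_eq_zero hφ L Finset.univ_nonempty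
    ((convex_stdSimplex ℝ ι).smul (N : ℝ)) ((isCompact_stdSimplex ℝ ι).smul (N : ℝ))]
  · refine Finset.sum_congr rfl fun S _ => ?_
    have : L '' (Set.indicator (S : Set ι) (1 : ι → ℝ) +ᵥ ((N - S.card : ℕ) : ℝ) • stdSimplex ℝ ι) =
        L (Set.indicator (S : Set ι) (1 : ι → ℝ)) +ᵥ ((((N - S.card : ℕ) : ℝ) • P : CB n) : Set (Euc n)) := by
      rw [ConvexBody.coe_smul, hP, ← Set.image_smul, ← Set.image_smul, ← Set.image_vadd,
        ← Set.image_vadd]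
      simp only [Set.image_image, vadd_eq_add, map_add, map_smul]
    rw [smul_stdSimplex_inter S (S.card_le_univ.trans hN), this, bodyExt_vadd hT]
  · intro t ht hle i hi
    rw [mem_smul_stdSimplex (Nat.cast_nonneg _)] at ht
    have h1 : ∑ j, (1 - t j) ≤ 0 := by
      rw [Finset.sum_sub_distrib, ht.2]
      simpa using hN
    have h2 := (Finset.sum_eq_zero_iff_of_nonneg fun j hj => sub_nonneg.2 (hle j hj)).1
      (le_antisymm h1 (Finset.sum_nonneg fun j hj => sub_nonneg.2 (hle j hj))) i hi
    linarith

theorem fwdDiff_iter_smul_eq_zero (hφ : IsVal φ) (hT : TransInv φ) (L : (ι → ℝ) →L[ℝ] Euc n)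
    [Nonempty ι] {P : CB n} (hP : (P : Set (Euc n)) = L '' stdSimplex ℝ ι) :
    (fwdDiff 1)^[Fintype.card ι] (fun k : ℕ => φ ((k : ℝ) • P)) = 0 := by
  ext y
  have h := sum_powerset_smul_eq_zero hφ hT L hP (Nat.le_add_left (Fintype.card ι) y)
  rw [Finset.sum_powerset_apply_card
    (fun m => (-1 : ℂ) ^ m * φ (((y + Fintype.card ι - m : ℕ) : ℝ) • P)), Finset.card_univ,
    ← Finset.sum_range_reflect] at h
  rw [fwdDiff_iter_eq_sum_shift, Pi.zero_apply, ← h]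
  refine Finset.sum_congr rfl fun k hk => ?_
  have hk' : k ≤ Fintype.card ι := Nat.lt_succ_iff.1 (Finset.mem_range.1 hk)
  rw [show Fintype.card ι + 1 - 1 - k = Fintype.card ι - k by lia, Nat.choose_symm hk',
    show y + Fintype.card ι - (Fintype.card ι - k) = y + k by lia]
  simp
  ring

end Simplex

section Growth

variable {n : ℕ} {φ : CB n → ℂ}

theorem exists_convexBody_of_tendsto {K : ℕ → CB n} {L : TopologicalSpace.NonemptyCompacts (Euc n)}
    (h : Filter.Tendsto (fun k => Metric.hausdorffDist (K k : Set (Euc n)) L) Filter.atTop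
      (nhds 0)) :
    ∃ M : CB n, Filter.Tendsto K Filter.atTop (nhds M) := by
  have htop : ∀ k, Metric.hausdorffEDist (K k : Set (Euc n)) L ≠ ⊤ := fun k =>
    Metric.hausdorffEDist_ne_top_of_nonempty_of_bounded (K k).nonempty L.nonempty
      (K k).isBounded L.isCompact.isBounded
  have cL : Convex ℝ (L : Set (Euc n)) := by
    intro x hx y hy a b ha hb hab
    rw [← L.isCompact.isClosed.closure_eq, Metric.mem_closure_iff]
    intro ε hε
    obtain ⟨k, hk⟩ := (h.eventually (gt_mem_nhds (half_pos hε))).exists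
    obtain ⟨x', hx', hxx⟩ := Metric.exists_dist_lt_of_hausdorffDist_lt' hx hk (htop k)
    obtain ⟨y', hy', hyy⟩ := Metric.exists_dist_lt_of_hausdorffDist_lt' hy hk (htop k)
    obtain ⟨z, hz, hzz⟩ := Metric.exists_dist_lt_of_hausdorffDist_lt
      ((K k).convex hx' hy' ha hb hab) hk (htop k)
    refine ⟨z, hz, ?_⟩
    have h1 : dist (a • x + b • y) (a • x' + b • y') ≤ ε / 2 := by
      refine (dist_add_add_le _ _ _ _).trans ?_
      rw [dist_smul₀, dist_smul₀, Real.norm_of_nonneg ha, Real.norm_of_nonneg hb]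
      rw [dist_comm] at hxx hyy
      nlinarith
    linarith [dist_triangle (a • x + b • y) (a • x' + b • y') z]
  refine ⟨⟨L, cL, L.isCompact, L.nonempty⟩, tendsto_iff_dist_tendsto_zero.2 h⟩

theorem exists_norm_le_of_subset (hφ : Continuous φ) {C : Set (Euc n)} (hC : IsCompact C) :
    ∃ B : ℝ, ∀ K : CB n, (K : Set (Euc n)) ⊆ C → ‖φ K‖ ≤ B := by
  by_contra! hcon
  choose K hKC hK using fun k : ℕ => hcon k
  let N : ℕ → TopologicalSpace.NonemptyCompacts (Euc n) := fun k =>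
    ⟨⟨K k, (K k).isCompact⟩, (K k).nonempty⟩
  obtain ⟨L, -, g, hg, hL⟩ :=
    (TopologicalSpace.NonemptyCompacts.isCompact_subsets_of_isCompact hC).tendsto_subseq
      (x := N) hKC
  obtain ⟨M, hM⟩ := exists_convexBody_of_tendsto (K := K ∘ g) (tendsto_iff_dist_tendsto_zero.1 hL)
  have hlim := ((hφ.tendsto M).comp hM).norm
  refine not_tendsto_atTop_of_tendsto_nhds hlim ?_
  refine Filter.tendsto_atTop_mono (fun k => (hK (g k)).le) ?_
  exact tendsto_natCast_atTop_atTop.comp hg.tendsto_atTop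

theorem isCompact_box (r : ℝ) : IsCompact {x : Euc n | ∀ j, x j ∈ Set.Icc (-r) r} := by
  have h : IsCompact (Set.univ.pi fun _ : Fin n => Set.Icc (-r) r) :=
    isCompact_univ_pi fun _ => isCompact_Icc
  convert h.image (PiLp.continuous_toLp 2 fun _ : Fin n => ℝ)
  ext x
  constructor
  · intro hx
    exact ⟨x.ofLp, fun j _ => hx j, rfl⟩
  · rintro ⟨y, hy, rfl⟩ j
    exact hy j trivial

theorem exists_norm_bodyExt_le (hφ : Continuous φ) (hT : TransInv φ) :
    ∃ B : ℝ, 0 ≤ B ∧ ∀ X : Set (Euc n), Convex ℝ X → IsCompact X →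
      (∀ j, ∃ a : ℝ, ∀ x ∈ X, x j ∈ Set.Icc a (a + 1)) → ‖bodyExt φ X‖ ≤ B := by
  obtain ⟨B, hB⟩ := exists_norm_le_of_subset hφ (isCompact_box (n := n) 1)
  refine ⟨max B 0, le_max_right _ _, fun X cX kX hX => ?_⟩
  rcases X.eq_empty_or_nonempty with rfl | ⟨y, hy⟩
  · simp [bodyExt_empty]
  let K : CB n := ⟨X, cX, kX, ⟨y, hy⟩⟩
  let K' : CB n := ⟨-y +ᵥ X, cX.vadd (-y), kX.vadd (-y), Set.Nonempty.vadd_set ⟨y, hy⟩⟩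
  have e : bodyExt φ X = φ K' := (bodyExt_coe K).trans (hT K K' (-y) rfl).symm
  rw [e]
  refine (hB K' ?_).trans (le_max_left _ _)
  rintro _ ⟨x, hx, rfl⟩ j
  obtain ⟨a, ha⟩ := hX j
  have h1 := ha x hx
  have h2 := ha y hy
  simp only [vadd_eq_add, PiLp.add_apply, PiLp.neg_apply, Set.mem_Icc] at *
  constructor <;> linarith

theorem norm_bodyExt_le_of_slab (hφ : IsVal φ) (j : Fin n) {B : ℝ} (hB : 0 ≤ B) {N : ℕ}
    (hN : 1 ≤ N) : ∀ {X : Set (Euc n)}, Convex ℝ X → IsCompact X →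
    (∀ Y ⊆ X, Convex ℝ Y → IsCompact Y →
      (∃ b : ℝ, ∀ x ∈ Y, x j ∈ Set.Icc b (b + 1)) → ‖bodyExt φ Y‖ ≤ B) →
    (∃ a : ℝ, ∀ x ∈ X, x j ∈ Set.Icc a (a + N)) → ‖bodyExt φ X‖ ≤ 2 * N * B := by
  induction N, hN using Nat.le_induction with
  | base =>
    rintro X cX kX h ⟨a, ha⟩
    have := h X subset_rfl cX kX ⟨a, by simpa using ha⟩
    push_cast
    linarith
  | succ N hN ih =>
    rintro X cX kX h ⟨a, ha⟩
    have hcut := bodyExt_cut hφ (ContinuousLinearMap.id ℝ (Euc n))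
      (EuclideanSpace.proj j : Euc n →L[ℝ] ℝ) (a + N) cX kX
    simp only [ContinuousLinearMap.coe_id', Set.image_id] at hcut
    have hl := (EuclideanSpace.proj j : Euc n →L[ℝ] ℝ).toLinearMap.isLinear
    have hc := (EuclideanSpace.proj j : Euc n →L[ℝ] ℝ).continuous
    have b1 := h _ Set.inter_subset_left (cX.inter (convex_halfSpace_ge hl (a + N)))
      (kX.inter_right (isClosed_le continuous_const hc)) ⟨a + N, fun x hx =>
        ⟨hx.2, (ha x hx.1).2.trans (by push_cast; linarith)⟩⟩
    have b2 := ih (cX.inter (convex_halfSpace_le hl (a + N)))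
      (kX.inter_right (isClosed_le hc continuous_const))
      (fun Y hY => h Y (hY.trans Set.inter_subset_left)) ⟨a, fun x hx => ⟨(ha x hx.1).1, hx.2⟩⟩
    have b3 := h _ Set.inter_subset_left (cX.inter (convex_hyperplane hl (a + N)))
      (kX.inter_right (isClosed_eq hc continuous_const)) ⟨a + N, fun x hx =>
        ⟨le_of_eq hx.2.symm, (le_of_eq hx.2).trans (by linarith)⟩⟩
    rw [hcut]
    refine (norm_sub_le _ _).trans ((add_le_add_left (norm_add_le _ _) _).trans ?_)
    refine (add_le_add (add_le_add b1 b2) b3).trans (le_of_eq ?_)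
    push_cast
    ring

theorem norm_bodyExt_le_of_box (hφ : IsVal φ) {B : ℝ} (hB : 0 ≤ B)
    (h : ∀ X : Set (Euc n), Convex ℝ X → IsCompact X →
      (∀ j, ∃ a : ℝ, ∀ x ∈ X, x j ∈ Set.Icc a (a + 1)) → ‖bodyExt φ X‖ ≤ B)
    {N : ℕ} (hN : 1 ≤ N) (s : Finset (Fin n)) : ∀ {X : Set (Euc n)}, Convex ℝ X → IsCompact X →
    (∀ j ∈ s, ∃ a : ℝ, ∀ x ∈ X, x j ∈ Set.Icc a (a + N)) →
    (∀ j ∉ s, ∃ a : ℝ, ∀ x ∈ X, x j ∈ Set.Icc a (a + 1)) →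
    ‖bodyExt φ X‖ ≤ (2 * N) ^ s.card * B := by
  induction s using Finset.cons_induction with
  | empty =>
    intro X cX kX _ h1
    simpa using h X cX kX fun j => h1 j (Finset.notMem_empty j)
  | cons i s hi ih =>
    intro X cX kX hs hns
    rw [Finset.card_cons, pow_succ', mul_assoc]
    refine norm_bodyExt_le_of_slab hφ i (by positivity) hN cX kX (fun Y hYX cY kY hY => ?_)
      (hs i (Finset.mem_cons_self i s))
    refine ih cY kY (fun j hj => ?_) fun j hj => ?_
    · obtain ⟨a, ha⟩ := hs j (Finset.mem_cons_of_mem hj)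
      exact ⟨a, fun x hx => ha x (hYX hx)⟩
    · by_cases hji : j = i
      · exact hji ▸ hY
      · obtain ⟨a, ha⟩ := hns j (by simp [hji, hj])
        exact ⟨a, fun x hx => ha x (hYX hx)⟩

theorem exists_norm_smul_le (hφ : GoodVal φ) (K : CB n) :
    ∃ C : ℝ, ∀ k : ℕ, 1 ≤ k → ‖φ ((k : ℝ) • K)‖ ≤ C * (k : ℝ) ^ n := by
  obtain ⟨B, hB, h⟩ := exists_norm_bodyExt_le hφ.2.1 hφ.2.2
  obtain ⟨R, hR⟩ := K.isBounded.exists_norm_le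
  obtain ⟨M, hM⟩ := exists_nat_ge (max 1 (2 * R))
  have hM1 : 1 ≤ M := by exact_mod_cast (le_max_left _ _).trans hM
  have hMR : 2 * R ≤ M := (le_max_right _ _).trans hM
  refine ⟨(2 * M) ^ n * B, fun k hk => ?_⟩
  have := norm_bodyExt_le_of_box hφ.1 hB h (Nat.mul_pos hk hM1) Finset.univ
    ((k : ℝ) • K).convex ((k : ℝ) • K).isCompact (fun j _ => ⟨-(k * R), ?_⟩) (by simp)
  · rw [bodyExt_coe, Finset.card_univ, Fintype.card_fin] at this
    refine this.trans (le_of_eq ?_)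
    push_cast
    ring
  · rintro _ ⟨x, hx, rfl⟩
    have hxj := abs_le.1 ((PiLp.norm_apply_le x j).trans (hR x hx))
    have hk0 : (0 : ℝ) ≤ k := Nat.cast_nonneg k
    have h1 := mul_le_mul_of_nonneg_left hxj.1 hk0
    have h2 := mul_le_mul_of_nonneg_left hxj.2 hk0
    have h3 := mul_le_mul_of_nonneg_left hMR hk0
    simp only [PiLp.smul_apply, smul_eq_mul, Set.mem_Icc]
    push_cast
    constructor <;> linarith

end Growth

section Polynomial

open Polynomial Filter Topology

theorem exists_eval_eq_of_fwdDiff_iter_eq_zero {f : ℕ → ℂ} {m : ℕ}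
    (h : (fwdDiff 1)^[m] f = 0) : ∃ p : ℂ[X], ∀ k : ℕ, p.eval (k : ℂ) = f k := by
  have hz : ∀ j, m ≤ j → (fwdDiff 1)^[j] f = 0 := by
    intro j hj
    obtain ⟨d, rfl⟩ := Nat.exists_eq_add_of_le hj
    rw [add_comm, Function.iterate_add_apply, h, Function.iterate_fixed]
    exact fwdDiff_const 1 (0 : ℂ)
  refine ⟨∑ j ∈ Finset.range m, C ((fwdDiff 1)^[j] f 0 / j.factorial) * descPochhammer ℂ j,
    fun k => ?_⟩
  have hk := shift_eq_sum_fwdDiff_iter 1 f k 0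
  rw [zero_add, smul_eq_mul, mul_one] at hk
  rw [hk, eval_finsetSum]
  have e1 : ∑ j ∈ Finset.range (k + 1), k.choose j • (fwdDiff 1)^[j] f 0 =
      ∑ j ∈ Finset.range (k + 1 + m), k.choose j • (fwdDiff 1)^[j] f 0 := by
    refine Finset.sum_subset (Finset.range_subset_range.2 (by lia)) fun j _ hj => ?_
    rw [Nat.choose_eq_zero_of_lt (by simpa using hj), zero_smul]
  have e2 : ∑ j ∈ Finset.range m, k.choose j • (fwdDiff 1)^[j] f 0 =
      ∑ j ∈ Finset.range (k + 1 + m), k.choose j • (fwdDiff 1)^[j] f 0 := by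
    refine Finset.sum_subset (Finset.range_subset_range.2 (by lia)) fun j _ hj => ?_
    rw [hz j (by simpa using hj), Pi.zero_apply, smul_zero]
  rw [e1, ← e2]
  refine Finset.sum_congr rfl fun j _ => ?_
  rw [nsmul_eq_mul, Nat.cast_choose_eq_descPochhammer_div ℂ, eval_mul, eval_C]
  ring

theorem natDegree_le_of_norm_eval_le {p : ℂ[X]} {n : ℕ} {c : ℝ}
    (h : ∀ k : ℕ, 1 ≤ k → ‖p.eval (k : ℂ)‖ ≤ c * (k : ℝ) ^ n) : p.natDegree ≤ n := by
  by_contra! hn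
  have hlim : Tendsto (fun k : ℕ => p.reverse.eval ((k : ℂ)⁻¹)) atTop (𝓝 (p.reverse.eval 0)) :=
    (p.reverse.continuous.tendsto 0).comp (tendsto_inv_atTop_nhds_zero_nat (𝕜 := ℂ))
  have hzero : Tendsto (fun k : ℕ => p.reverse.eval ((k : ℂ)⁻¹)) atTop (𝓝 0) := by
    have hc : Tendsto (fun k : ℕ => c * ((k : ℝ)⁻¹)) atTop (𝓝 0) := by
      simpa using (tendsto_inv_atTop_nhds_zero_nat (𝕜 := ℝ)).const_mul c
    refine squeeze_zero_norm' ?_ hc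
    filter_upwards [eventually_ge_atTop 1] with k hk
    have hk0 : (0 : ℝ) < k := by exact_mod_cast hk
    have hkC : (k : ℂ) ≠ 0 := by exact_mod_cast hk0.ne'
    let _ : Invertible (k : ℂ) := invertibleOfNonzero hkC
    have e := eval₂_reverse_mul_pow (RingHom.id ℂ) (k : ℂ) p
    rw [invOf_eq_inv] at e
    change eval _ _ * _ = eval _ _ at e
    have hp := h k hk
    have hc0 : 0 ≤ c := by
      have := (norm_nonneg _).trans hp
      exact nonneg_of_mul_nonneg_left this (by positivity)
    rw [← e, norm_mul, norm_pow, Complex.norm_natCast] at hp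
    have hpow : (k : ℝ) ^ (n + 1) ≤ (k : ℝ) ^ p.natDegree :=
      pow_le_pow_right₀ (by exact_mod_cast hk) hn
    rw [← div_eq_mul_inv, le_div_iff₀ hk0]
    have h1 := (mul_le_mul_of_nonneg_left hpow (norm_nonneg (p.reverse.eval ((k : ℂ)⁻¹)))).trans hp
    rw [pow_succ', ← mul_assoc] at h1
    exact le_of_mul_le_mul_right h1 (by positivity)
  have := tendsto_nhds_unique hlim hzero
  rw [← coeff_zero_eq_eval_zero, coeff_zero_reverse, leadingCoeff_eq_zero] at this
  simp [this] at hn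

theorem eq_of_sum_mul_pow_eq {n : ℕ} {a b : Fin n → ℂ}
    (h : ∀ k : ℕ, 1 ≤ k → ∑ i : Fin n, a i * (k : ℂ) ^ (i : ℕ) =
      ∑ i : Fin n, b i * (k : ℂ) ^ (i : ℕ)) : a = b := by
  have hpoly : ∑ i : Fin n, (C (a i) * X ^ (i : ℕ) : ℂ[X]) =
      ∑ i : Fin n, C (b i) * X ^ (i : ℕ) := by
    refine eq_of_infinite_eval_eq _ _ (Set.Infinite.mono ?_
      (Set.infinite_range_of_injective
        (f := fun k : ℕ => ((k + 1 : ℕ) : ℂ)) fun x y hxy => by simpa using hxy))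
    rintro _ ⟨k, rfl⟩
    simpa [eval_finsetSum] using h (k + 1) (by lia)
  ext i
  have := congrArg (fun p => coeff p (i : ℕ)) hpoly
  simpa [finsetSum_coeff, coeff_C_mul, coeff_X_pow, Fin.val_inj] using this

end Polynomial

section Dilation

variable {n : ℕ} {φ : CB n → ℂ}

theorem ConvexBody.continuous_const_smul (c : ℝ) : Continuous fun K : CB n => c • K := by
  refine (LipschitzWith.of_dist_le_mul (K := ‖c‖₊) fun K L => ?_).continuous
  refine Metric.hausdorffDist_le_of_infDist (by positivity) ?_ ?_
  · rintro _ ⟨x, hx, rfl⟩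
    obtain ⟨y, hy, hxy⟩ := L.isCompact.exists_infDist_eq_dist L.nonempty x
    refine (Metric.infDist_le_dist_of_mem (Set.smul_mem_smul_set hy)).trans ?_
    rw [dist_smul₀, ← hxy]
    exact mul_le_mul_of_nonneg_left
      (Metric.infDist_le_hausdorffDist_of_mem hx ConvexBody.hausdorffEDist_ne_top) (norm_nonneg c)
  · rintro _ ⟨x, hx, rfl⟩
    obtain ⟨y, hy, hxy⟩ := K.isCompact.exists_infDist_eq_dist K.nonempty x
    refine (Metric.infDist_le_dist_of_mem (Set.smul_mem_smul_set hy)).trans ?_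
    rw [dist_smul₀, ← hxy, dist_comm K L]
    exact mul_le_mul_of_nonneg_left
      (Metric.infDist_le_hausdorffDist_of_mem hx ConvexBody.hausdorffEDist_ne_top) (norm_nonneg c)

theorem ConvexBody.continuous_smul_const (K : CB n) : Continuous fun c : ℝ => c • K := by
  obtain ⟨R, hR⟩ := K.isBounded.exists_norm_le
  have hR0 : 0 ≤ R := by
    obtain ⟨x, hx⟩ := K.nonempty
    exact (norm_nonneg x).trans (hR x hx)
  refine (LipschitzWith.of_dist_le_mul (K := ⟨R, hR0⟩) fun c d => ?_).continuous
  have key : ∀ a b : ℝ, ∀ x ∈ ((a • K : CB n) : Set (Euc n)),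
      ∃ y ∈ ((b • K : CB n) : Set (Euc n)), dist x y ≤ R * dist a b := by
    rintro a b _ ⟨x, hx, rfl⟩
    refine ⟨b • x, Set.smul_mem_smul_set hx, ?_⟩
    change dist (a • x) (b • x) ≤ _
    rw [dist_eq_norm, ← sub_smul, norm_smul, mul_comm, dist_eq_norm]
    exact mul_le_mul_of_nonneg_right (hR x hx) (norm_nonneg _)
  refine Metric.hausdorffDist_le_of_mem_dist (mul_nonneg hR0 dist_nonneg) (key c d) ?_
  rw [dist_comm]
  exact key d c

theorem GoodVal.comp_smul (hφ : GoodVal φ) (c : ℝ) : GoodVal fun K => φ (c • K) := by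
  obtain ⟨hV, hC, hT⟩ := hφ
  refine ⟨fun A B U I hU hI => ?_, hC.comp (ConvexBody.continuous_const_smul c),
    fun K L x h => ?_⟩
  · refine hV _ _ _ _ (by simp only [ConvexBody.coe_smul, hU, Set.smul_set_union]) ?_
    simp only [ConvexBody.coe_smul]
    rcases eq_or_ne c 0 with rfl | hc
    · rw [Set.zero_smul_set A.nonempty, Set.zero_smul_set B.nonempty, Set.zero_smul_set I.nonempty,
        Set.inter_self]
    · rw [hI, Set.smul_set_inter₀ hc]
  · refine hT _ _ (c • x) ?_
    simp only [ConvexBody.coe_smul, h, ← Set.image_smul, ← Set.image_vadd, Set.image_image,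
      vadd_eq_add, smul_add]

theorem GoodVal.sum_mul {ι : Type*} {s : Finset ι} {ψ : ι → CB n → ℂ}
    (h : ∀ i ∈ s, GoodVal (ψ i)) (c : ι → ℂ) : GoodVal fun K => ∑ i ∈ s, ψ i K * c i := by
  refine ⟨fun A B U I hU hI => ?_, ?_, fun K L x hx => ?_⟩
  · rw [← Finset.sum_add_distrib, ← Finset.sum_sub_distrib]
    refine Finset.sum_congr rfl fun i hi => ?_
    rw [(h i hi).1 A B U I hU hI]
    ring
  · exact continuous_finsetSum s fun i hi => (h i hi).2.1.mul continuous_const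
  · exact Finset.sum_congr rfl fun i hi => by rw [(h i hi).2.2 K L x hx]

theorem Homog.of_nat {ψ : CB n → ℂ} (hψ : Continuous ψ) {i : ℕ}
    (h : ∀ m : ℕ, 1 ≤ m → ∀ K, ψ ((m : ℝ) • K) = (m : ℂ) ^ i * ψ K) : Homog i ψ := by
  intro l hl K
  have hclosed : IsClosed {l : ℝ | ψ (l • K) = (l : ℂ) ^ i * ψ K} :=
    isClosed_eq (hψ.comp K.continuous_smul_const)
      ((Complex.continuous_ofReal.pow i).mul continuous_const)
  have hsub : Set.Ioi (0 : ℝ) ∩ Set.range ((↑) : ℚ → ℝ) ⊆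
      {l : ℝ | ψ (l • K) = (l : ℂ) ^ i * ψ K} := by
    rintro _ ⟨hq, q, rfl⟩
    have hq0 : 0 < q := Rat.cast_pos.1 (Set.mem_Ioi.1 hq)
    have hd : (q.den : ℂ) ≠ 0 := by exact_mod_cast q.den_ne_zero
    have hnum : 0 < q.num := Rat.num_pos.2 hq0
    have hqd : q.den * q = q.num.toNat := by
      have h1 : ((q.num.toNat : ℤ) : ℚ) = q.num := by rw [Int.toNat_of_nonneg hnum.le]
      rw [← Int.cast_natCast (n := q.num.toNat), h1, mul_comm, Rat.mul_den_eq_num]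
    have e1 := h q.den q.den_pos ((q : ℝ) • K)
    have e2 := h q.num.toNat (by lia) K
    have hR : (q.den : ℝ) * (q : ℝ) = q.num.toNat := by exact_mod_cast hqd
    have hC : (q.den : ℂ) * (q : ℂ) = q.num.toNat := by exact_mod_cast hqd
    rw [smul_smul, hR, e2, ← hC, mul_pow, mul_assoc] at e1
    change ψ ((q : ℝ) • K) = ((q : ℝ) : ℂ) ^ i * ψ K
    rw [Complex.ofReal_ratCast]
    exact (mul_left_cancel₀ (pow_ne_zero i hd) e1).symm
  exact (closure_minimal hsub hclosed)
    (Rat.denseRange_cast.open_subset_closure_inter isOpen_Ioi hl)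

end Dilation

section Approximation

variable {n : ℕ}

theorem dense_polytopes :
    Dense {P : CB n | ∃ s : Set (Euc n), s.Finite ∧ (P : Set (Euc n)) = convexHull ℝ s} := by
  intro K
  rw [Metric.mem_closure_iff]
  intro ε hε
  obtain ⟨s, hsK, hs, hcov⟩ := K.isCompact.finite_cover_balls (half_pos hε)
  have hne : s.Nonempty := by
    obtain ⟨x, hx⟩ := K.nonempty
    obtain ⟨y, hy, -⟩ := Set.mem_iUnion₂.1 (hcov hx)
    exact ⟨y, hy⟩
  refine ⟨⟨convexHull ℝ s, convex_convexHull ℝ s, hs.isCompact_convexHull (𝕜 := ℝ),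
    hne.convexHull⟩, ⟨s, hs, rfl⟩, ?_⟩
  refine lt_of_le_of_lt (Metric.hausdorffDist_le_of_mem_dist (half_pos hε).le (fun x hx => ?_)
    fun x hx => ?_) (half_lt_self hε)
  · obtain ⟨y, hy, hxy⟩ := Set.mem_iUnion₂.1 (hcov hx)
    exact ⟨y, subset_convexHull ℝ s hy, (Metric.mem_ball.1 hxy).le⟩
  · exact ⟨x, convexHull_min hsK K.convex hx, by simpa using (half_pos hε).le⟩

end Approximation

section Decomposition

open Polynomial

variable {n : ℕ} {φ : CB n → ℂ}

theorem exists_polynomial_of_polytope (hφ : GoodVal φ) {P : CB n} {s : Set (Euc n)}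
    (hs : s.Finite) (hP : (P : Set (Euc n)) = convexHull ℝ s) :
    ∃ p : ℂ[X], p.natDegree ≤ n ∧ ∀ k : ℕ, p.eval (k : ℂ) = φ ((k : ℝ) • P) := by
  let _ := hs.fintype
  have : Nonempty s := by
    rw [Set.nonempty_coe_sort, ← convexHull_nonempty_iff (𝕜 := ℝ), ← hP]
    exact P.nonempty
  rw [hs.convexHull_eq_image] at hP
  obtain ⟨p, hp⟩ := exists_eval_eq_of_fwdDiff_iter_eq_zero
    (fwdDiff_iter_smul_eq_zero hφ.1 hφ.2.2 (LinearMap.toContinuousLinearMap _) hP)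
  obtain ⟨c, hc⟩ := exists_norm_smul_le hφ P
  exact ⟨p, natDegree_le_of_norm_eval_le fun k hk => hp k ▸ hc k hk, hp⟩

/-- The `j`-th Lagrange basis polynomial for the nodes `0, …, n`. -/
def natLagrange (n j : ℕ) : ℂ[X] :=
  Lagrange.basis (Finset.range (n + 1)) (fun k : ℕ => (k : ℂ)) j

theorem natDegree_natLagrange {n j : ℕ} (hj : j ∈ Finset.range (n + 1)) :
    (natLagrange n j).natDegree = n := by
  simp [natLagrange, Lagrange.natDegree_basis Nat.cast_injective.injOn hj]

theorem smul_eq_sum_natLagrange (hφ : GoodVal φ) (k : ℕ) (K : CB n) :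
    φ ((k : ℝ) • K) =
      ∑ j ∈ Finset.range (n + 1), φ ((j : ℝ) • K) * (natLagrange n j).eval (k : ℂ) := by
  have hclosed : IsClosed {K : CB n | φ ((k : ℝ) • K) =
      ∑ j ∈ Finset.range (n + 1), φ ((j : ℝ) • K) * (natLagrange n j).eval (k : ℂ)} :=
    isClosed_eq (hφ.comp_smul k).2.1
      (GoodVal.sum_mul (fun (j : ℕ) _ => hφ.comp_smul (j : ℝ)) _).2.1
  refine closure_minimal ?_ hclosed (dense_polytopes K)
  rintro P ⟨s, hs, hP⟩
  obtain ⟨p, hpn, hp⟩ := exists_polynomial_of_polytope hφ hs hP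
  have hdeg : p.degree < (Finset.range (n + 1)).card := by
    rw [Finset.card_range]
    exact degree_le_natDegree.trans_lt (by exact_mod_cast Nat.lt_succ_of_le hpn)
  have := congrArg (eval (k : ℂ)) (Lagrange.eq_interpolate (v := fun k : ℕ => (k : ℂ))
    Nat.cast_injective.injOn hdeg)
  simpa [Lagrange.interpolate_apply, eval_finsetSum, hp, natLagrange] using this

/-- The `i`-homogeneous component of a valuation. -/
def homogComponent (φ : CB n → ℂ) (i : ℕ) (K : CB n) : ℂ :=
  ∑ j ∈ Finset.range (n + 1), φ ((j : ℝ) • K) * (natLagrange n j).coeff i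

theorem smul_eq_sum_homogComponent (hφ : GoodVal φ) (k : ℕ) (K : CB n) :
    φ ((k : ℝ) • K) = ∑ i : Fin (n + 1), homogComponent φ i K * (k : ℂ) ^ (i : ℕ) := by
  rw [smul_eq_sum_natLagrange hφ, Fin.sum_univ_eq_sum_range
    (fun i => homogComponent φ i K * (k : ℂ) ^ i)]
  simp only [homogComponent, Finset.sum_mul]
  rw [Finset.sum_comm]
  refine Finset.sum_congr rfl fun j hj => ?_
  rw [eval_eq_sum_range, natDegree_natLagrange hj, Finset.mul_sum]
  exact Finset.sum_congr rfl fun i _ => (mul_assoc _ _ _).symm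

theorem goodVal_homogComponent (hφ : GoodVal φ) (i : ℕ) : GoodVal (homogComponent φ i) :=
  GoodVal.sum_mul (fun (j : ℕ) _ => hφ.comp_smul (j : ℝ)) _

theorem homog_homogComponent (hφ : GoodVal φ) (i : Fin (n + 1)) :
    Homog (i : ℕ) (homogComponent φ i) := by
  refine Homog.of_nat (goodVal_homogComponent hφ i).2.1 fun m _ K => ?_
  refine congrFun (eq_of_sum_mul_pow_eq
    (a := fun i : Fin (n + 1) => homogComponent φ i ((m : ℝ) • K))
    (b := fun i : Fin (n + 1) => (m : ℂ) ^ (i : ℕ) * homogComponent φ i K) fun k _ => ?_) i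
  rw [← smul_eq_sum_homogComponent hφ, smul_smul, ← Nat.cast_mul, smul_eq_sum_homogComponent hφ]
  refine Finset.sum_congr rfl fun i _ => ?_
  push_cast
  ring

end Decomposition

/-- **McMullen's homogeneous decomposition** `Val(V) = ⊕_{i=0}^n Val_i(V)`:
every translation invariant continuous convex valuation on `ℝⁿ` is, in a unique way,
the sum of translation invariant continuous convex valuations `φ₀, …, φₙ` with `φᵢ`
being `i`-homogeneous. -/
theorem mcmullen_decomposition {n : ℕ} (hn : 1 ≤ n) (φ : CB n → ℂ) (hφ : GoodVal φ) :
    ∃! ψ : Fin (n + 1) → (CB n → ℂ),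
      (∀ i : Fin (n + 1), GoodVal (ψ i) ∧ Homog (i : ℕ) (ψ i)) ∧
      ∀ K : CB n, φ K = ∑ i : Fin (n + 1), ψ i K := by
  refine ⟨fun i => homogComponent φ i, ⟨fun i => ⟨goodVal_homogComponent hφ i,
    homog_homogComponent hφ i⟩, fun K => ?_⟩, fun ψ ⟨hψ, hsum⟩ => ?_⟩
  · simpa using smul_eq_sum_homogComponent hφ 1 K
  · funext i K
    refine congrFun (eq_of_sum_mul_pow_eq (a := fun i => ψ i K)
      (b := fun i : Fin (n + 1) => homogComponent φ i K) fun k hk => ?_) i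
    rw [← smul_eq_sum_homogComponent hφ, hsum]
    refine Finset.sum_congr rfl fun i _ => ?_
    rw [(hψ i).2 k (by exact_mod_cast hk) K, Complex.ofReal_natCast, mul_comm]
end
end

section
/- (Hadwiger) Let n ≥ 1 and let φ be a translation invariant continuous convex valuation on ℝⁿ which is n-homogeneous, i.e. φ(λK) = λⁿ·φ(K) for all λ > 0 and K ∈ 𝒦(ℝⁿ). Then there exists c ∈ ℂ such that φ(K) = c · vol(K) for every K ∈ 𝒦(ℝⁿ), where vol is the Lebesgue measure on ℝⁿ. (Valₙ(V) is one dimensional and spanned by Lebesgue measure.) -/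
open scoped Pointwise

noncomputable section

/-- The set of points with nonstrict coordinate bounds `t ≤ x i ≤ t + 1`. -/
def slab {n : ℕ} (i : Fin n) (t : ℝ) : Set (Euc n) := {x | t ≤ x i ∧ x i ≤ t + 1}

/-- The coordinate hyperplane `x i = t`. -/
def hyper {n : ℕ} (i : Fin n) (t : ℝ) : Set (Euc n) := {x | x i = t}

/-- The face of the unit grid cube with lowest corner `z` on which the coordinates in `J` are
minimal. -/
def face {n : ℕ} (z : Fin n → ℕ) (J : Finset (Fin n)) : Set (Euc n) :=
  {x | ∀ i, (z i : ℝ) ≤ x i ∧ x i ≤ z i + 1 ∧ (i ∈ J → x i = z i)}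

/-- A translation invariant, `n`-homogeneous set function on the compact convex sets which is
additive under cuts by coordinate hyperplanes and bounded on the subsets of the unit cube. -/
structure IsGridVal {n : ℕ} (ψ : Set (Euc n) → ℂ) : Prop where
  map_empty : ψ ∅ = 0
  cut : ∀ S, Convex ℝ S → IsCompact S → ∀ (i : Fin n) (t : ℝ),
    ψ S = ψ (S ∩ {x | x i ≤ t}) + ψ (S ∩ {x | t ≤ x i}) - ψ (S ∩ {x | x i = t})
  trans : ∀ S, Convex ℝ S → IsCompact S → ∀ v : Euc n, ψ (v +ᵥ S) = ψ S
  bdd : ∃ B : ℝ, 0 ≤ B ∧ ∀ S, Convex ℝ S → IsCompact S → S ⊆ face 0 ∅ → ‖ψ S‖ ≤ B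
  homog : ∀ S, Convex ℝ S → IsCompact S → ∀ N : ℕ, 0 < N →
    ψ ((N : ℝ) • S) = (N : ℂ) ^ n * ψ S

/-- The inclusion-exclusion sum over the faces of a grid cube. -/
def cellSum {n : ℕ} (ψ : Set (Euc n) → ℂ) (z : Fin n → ℕ) (S : Set (Euc n)) : ℂ :=
  ∑ J : Finset (Fin n), (-1) ^ J.card * ψ (S ∩ face z J)

section Halfspaces

variable {n : ℕ}

lemma coord_continuous (i : Fin n) : Continuous fun x : Euc n => x i := by fun_prop

lemma coord_isLinear (i : Fin n) : IsLinearMap ℝ fun x : Euc n => x i :=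
  ⟨fun _ _ => rfl, fun _ _ => rfl⟩

lemma convex_coord_le (i : Fin n) (t : ℝ) : Convex ℝ {x : Euc n | x i ≤ t} :=
  convex_halfSpace_le (coord_isLinear i) t

lemma convex_coord_ge (i : Fin n) (t : ℝ) : Convex ℝ {x : Euc n | t ≤ x i} :=
  convex_halfSpace_ge (coord_isLinear i) t

lemma isClosed_coord_le (i : Fin n) (t : ℝ) : IsClosed {x : Euc n | x i ≤ t} :=
  isClosed_le (coord_continuous i) continuous_const

lemma isClosed_coord_ge (i : Fin n) (t : ℝ) : IsClosed {x : Euc n | t ≤ x i} :=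
  isClosed_le continuous_const (coord_continuous i)

lemma convex_slab (i : Fin n) (t : ℝ) : Convex ℝ (slab i t) :=
  (convex_coord_ge i t).inter (convex_coord_le i (t + 1))

lemma isClosed_slab (i : Fin n) (t : ℝ) : IsClosed (slab i t) :=
  (isClosed_coord_ge i t).inter (isClosed_coord_le i (t + 1))

lemma convex_hyper (i : Fin n) (t : ℝ) : Convex ℝ (hyper i t) :=
  convex_hyperplane (coord_isLinear i) t

lemma isClosed_hyper (i : Fin n) (t : ℝ) : IsClosed (hyper i t) :=
  isClosed_eq (coord_continuous i) continuous_const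

lemma face_eq (z : Fin n → ℕ) (J : Finset (Fin n)) :
    face z J = (⋂ i ∈ Jᶜ, slab i (z i)) ∩ ⋂ i ∈ J, hyper i (z i) := by
  ext x
  simp only [face, slab, hyper, Set.mem_ofPred_eq, Set.mem_inter_iff, Set.mem_iInter,
    Finset.mem_compl]
  constructor
  · exact fun h => ⟨fun i _ => ⟨(h i).1, (h i).2.1⟩, fun i => (h i).2.2⟩
  · rintro ⟨h₁, h₂⟩ i
    by_cases hi : i ∈ J
    · have := h₂ i hi
      exact ⟨this.ge, by linarith, fun _ => this⟩
    · exact ⟨(h₁ i hi).1, (h₁ i hi).2, fun h => absurd h hi⟩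

lemma convex_face (z : Fin n → ℕ) (J : Finset (Fin n)) : Convex ℝ (face z J) := by
  rw [face_eq]
  exact (convex_iInter₂ fun i _ => convex_slab i _).inter
    (convex_iInter₂ fun i _ => convex_hyper i _)

lemma isClosed_face (z : Fin n → ℕ) (J : Finset (Fin n)) : IsClosed (face z J) := by
  rw [face_eq]
  exact (isClosed_biInter fun i _ => isClosed_slab i _).inter
    (isClosed_biInter fun i _ => isClosed_hyper i _)

/-- The lowest corner of a grid cube. -/
def corner (z : Fin n → ℕ) : Euc n := WithLp.toLp 2 fun i => (z i : ℝ)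

lemma mem_neg_corner_vadd {z : Fin n → ℕ} {S : Set (Euc n)} {x : Euc n} :
    x ∈ -corner z +ᵥ S ↔ corner z + x ∈ S := by
  rw [Set.mem_vadd_set_iff_neg_vadd_mem, neg_neg, vadd_eq_add]

lemma neg_corner_vadd_face (z : Fin n → ℕ) (J : Finset (Fin n)) :
    -corner z +ᵥ face z J = face 0 J := by
  ext x
  rw [mem_neg_corner_vadd]
  simp [face, corner]

lemma face_subset_face_empty (z : Fin n → ℕ) (J : Finset (Fin n)) : face z J ⊆ face z ∅ :=
  fun _ hx i => ⟨(hx i).1, (hx i).2.1, by simp⟩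

lemma isBounded_of_coord {S : Set (Euc n)} {a b : ℝ} (h : ∀ x ∈ S, ∀ i, a ≤ x i ∧ x i ≤ b) :
    Bornology.IsBounded S := by
  have h₁ : Bornology.IsBounded (WithLp.toLp 2 '' Set.Icc (fun _ : Fin n => a) fun _ => b) :=
    (isCompact_Icc.image (PiLp.continuous_toLp 2 _)).isBounded
  refine h₁.subset fun x hx => ⟨WithLp.ofLp x, ⟨fun i => (h x hx i).1, fun i => (h x hx i).2⟩, rfl⟩

lemma isCompact_face_zero : IsCompact (face (0 : Fin n → ℕ) ∅) :=
  Metric.isCompact_of_isClosed_isBounded (isClosed_face _ _)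
    (isBounded_of_coord (a := 0) (b := 1) fun x hx i => by
      have := hx i
      simp only [Pi.zero_apply, Nat.cast_zero, zero_add] at this
      exact ⟨this.1, this.2.1⟩)

end Halfspaces

section Grid

variable {n : ℕ} {ψ : Set (Euc n) → ℂ}

lemma IsGridVal.sum_slab (h : IsGridVal ψ) {S : Set (Euc n)} (hc : Convex ℝ S)
    (hk : IsCompact S) (i : Fin n) (hpos : ∀ x ∈ S, 0 < x i) (m : ℕ) :
    ∑ k ∈ Finset.range m, (ψ (S ∩ slab i k) - ψ (S ∩ hyper i k)) = ψ (S ∩ {x | x i ≤ m}) := by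
  induction m with
  | zero =>
    have : S ∩ {x | x i ≤ ((0 : ℕ) : ℝ)} = ∅ := by
      ext x
      simp only [Nat.cast_zero, Set.mem_inter_iff, Set.mem_ofPred_eq, Set.mem_empty_iff_false,
        iff_false, not_and, not_le]
      exact hpos x
    rw [this, h.map_empty, Finset.range_zero, Finset.sum_empty]
  | succ m ih =>
    have hcut := h.cut _ (hc.inter (convex_coord_le i ((m + 1 : ℕ) : ℝ)))
      (hk.inter_right (isClosed_coord_le i _)) i m
    have h₁ : S ∩ {x | x i ≤ ((m + 1 : ℕ) : ℝ)} ∩ {x | x i ≤ m} = S ∩ {x | x i ≤ m} := by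
      ext x
      simp only [Nat.cast_add, Nat.cast_one, Set.mem_inter_iff, Set.mem_ofPred_eq]
      exact ⟨fun h => ⟨h.1.1, h.2⟩, fun h => ⟨⟨h.1, by linarith [h.2]⟩, h.2⟩⟩
    have h₂ : S ∩ {x | x i ≤ ((m + 1 : ℕ) : ℝ)} ∩ {x | m ≤ x i} = S ∩ slab i m := by
      ext x
      simp only [slab, Nat.cast_add, Nat.cast_one, Set.mem_inter_iff, Set.mem_ofPred_eq]
      tauto
    have h₃ : S ∩ {x | x i ≤ ((m + 1 : ℕ) : ℝ)} ∩ {x | x i = m} = S ∩ hyper i m := by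
      ext x
      simp only [hyper, Nat.cast_add, Nat.cast_one, Set.mem_inter_iff, Set.mem_ofPred_eq]
      exact ⟨fun h => ⟨h.1.1, h.2⟩, fun h => ⟨⟨h.1, by linarith [h.2]⟩, h.2⟩⟩
    rw [Finset.sum_range_succ, ih, hcut, h₁, h₂, h₃]
    ring

/-- The action of the algebra of sets under intersection on set functions by restriction. -/
def restrict (E : Type*) :
    MonoidAlgebra ℂ (AsBoolRing (Set E)) →ₐ[ℂ] Module.End ℂ (Set E → ℂ) :=
  MonoidAlgebra.lift ℂ _ _
    { toFun := fun A =>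
        { toFun := fun ψ S => ψ (S ∩ ofBoolRing A)
          map_add' := fun _ _ => rfl
          map_smul' := fun _ _ => rfl }
      map_one' := by
        ext ψ S
        simp
      map_mul' := fun A B => by
        ext ψ S
        simp [Set.inter_assoc] }

/-- The generator of the algebra of sets given by a set. -/
def setGen {E : Type*} (A : Set E) : MonoidAlgebra ℂ (AsBoolRing (Set E)) :=
  MonoidAlgebra.of ℂ _ (toBoolRing A)

lemma restrict_setGen {E : Type*} (A : Set E) (ψ : Set E → ℂ) (S : Set E) :
    restrict E (setGen A) ψ S = ψ (S ∩ A) := by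
  simp [restrict, setGen]

lemma setGen_inter {E : Type*} (A B : Set E) : setGen (A ∩ B) = setGen A * setGen B := by
  rw [setGen, setGen, setGen, ← map_mul, ← toBoolRing_inf]
  rfl

lemma setGen_biInter {E ι : Type*} (T : Finset ι) (A : ι → Set E) :
    setGen (⋂ i ∈ T, A i) = ∏ i ∈ T, setGen (A i) := by
  classical
  induction T using Finset.induction_on with
  | empty => simp [setGen]; rfl
  | insert i T hi ih => rw [Finset.prod_insert hi, Finset.set_biInter_insert, setGen_inter, ih]

lemma IsGridVal.restrict_prod (h : IsGridVal ψ) (m : ℕ) (T : Finset (Fin n))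
    {S : Set (Euc n)} (hc : Convex ℝ S) (hk : IsCompact S)
    (hS : ∀ x ∈ S, ∀ i, 0 < x i ∧ x i ≤ m) :
    restrict _ (∏ i ∈ T, ∑ k ∈ Finset.range m,
      (setGen (slab i (k : ℝ)) - setGen (hyper i (k : ℝ)))) ψ S = ψ S := by
  induction T using Finset.induction_on generalizing S with
  | empty => simp
  | insert i T hi ih =>
    rw [Finset.prod_insert hi, map_mul, Module.End.mul_apply, map_sum, LinearMap.sum_apply,
      Finset.sum_apply]
    have key := h.sum_slab hc hk i (fun x hx => (hS x hx i).1) m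
    have hle : S ∩ {x | x i ≤ m} = S := Set.inter_eq_left.2 fun x hx => (hS x hx i).2
    rw [hle] at key
    rw [← key]
    refine Finset.sum_congr rfl fun k _ => ?_
    rw [map_sub, LinearMap.sub_apply, Pi.sub_apply, restrict_setGen, restrict_setGen,
      ih (hc.inter (convex_slab i _)) (hk.inter_right (isClosed_slab i _))
        fun x hx => hS x hx.1,
      ih (hc.inter (convex_hyper i _)) (hk.inter_right (isClosed_hyper i _))
        fun x hx => hS x hx.1]

lemma restrict_prod_eq_cellSum (z : Fin n → ℕ) (S : Set (Euc n)) :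
    restrict _ (∏ i, (setGen (slab i (z i : ℝ)) - setGen (hyper i (z i : ℝ)))) ψ S
      = cellSum ψ z S := by
  rw [Finset.prod_sub, Finset.powerset_univ, map_sum, LinearMap.sum_apply, Finset.sum_apply,
    cellSum]
  refine Finset.sum_congr rfl fun J _ => ?_
  rw [mul_assoc, ← setGen_biInter, ← setGen_biInter, ← setGen_inter,
    ← Finset.compl_eq_univ_sdiff, ← face_eq]
  rcases Nat.even_or_odd J.card with h | h <;> simp [h.neg_one_pow, restrict_setGen]

lemma IsGridVal.eq_sum_cellSum (h : IsGridVal ψ) (m : ℕ) {S : Set (Euc n)} (hc : Convex ℝ S)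
    (hk : IsCompact S) (hS : ∀ x ∈ S, ∀ i, 0 < x i ∧ x i ≤ m) :
    ψ S = ∑ z ∈ Fintype.piFinset fun _ : Fin n => Finset.range m, cellSum ψ z S := by
  rw [← h.restrict_prod m Finset.univ hc hk hS, Finset.prod_univ_sum, map_sum,
    LinearMap.sum_apply, Finset.sum_apply]
  exact Finset.sum_congr rfl fun z _ => restrict_prod_eq_cellSum z S

lemma IsGridVal.norm_cellSum_le (h : IsGridVal ψ) {B : ℝ}
    (hB : ∀ S, Convex ℝ S → IsCompact S → S ⊆ face 0 ∅ → ‖ψ S‖ ≤ B) {S : Set (Euc n)}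
    (hc : Convex ℝ S) (hk : IsCompact S) (z : Fin n → ℕ) : ‖cellSum ψ z S‖ ≤ 2 ^ n * B := by
  calc ‖cellSum ψ z S‖ ≤ ∑ _J : Finset (Fin n), B := by
        refine norm_sum_le_of_le _ fun J _ => ?_
        have hc' := hc.inter (convex_face z J)
        have hk' := hk.inter_right (isClosed_face z J)
        rw [norm_mul, norm_pow, norm_neg, norm_one, one_pow, one_mul,
          ← h.trans _ hc' hk' (-corner z)]
        refine hB _ (hc'.vadd _) (hk'.vadd _) ?_
        rw [← neg_corner_vadd_face z ∅]
        exact Set.vadd_set_mono (Set.inter_subset_right.trans (face_subset_face_empty z J))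
    _ = 2 ^ n * B := by simp

lemma IsGridVal.cellSum_of_subset (h : IsGridVal ψ) {S : Set (Euc n)} {z : Fin n → ℕ}
    (hz : face z ∅ ⊆ S) : cellSum ψ z S = cellSum ψ 0 Set.univ := by
  refine Finset.sum_congr rfl fun J _ => ?_
  have hk : IsCompact (face z J) := by
    have : face z J = corner z +ᵥ face 0 J := by
      rw [← neg_corner_vadd_face z J, vadd_vadd, add_neg_cancel, zero_vadd]
    rw [this]
    exact (isCompact_face_zero.of_isClosed_subset (isClosed_face _ _)
      (face_subset_face_empty _ _)).vadd _
  rw [Set.univ_inter, Set.inter_eq_right.2 ((face_subset_face_empty z J).trans hz),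
    ← neg_corner_vadd_face z J, h.trans _ (convex_face z J) hk]

lemma IsGridVal.cellSum_of_disjoint (h : IsGridVal ψ) {S : Set (Euc n)} {z : Fin n → ℕ}
    (hz : ¬ (face z ∅ ∩ S).Nonempty) : cellSum ψ z S = 0 := by
  refine Finset.sum_eq_zero fun J _ => ?_
  have : S ∩ face z J = ∅ := by
    rw [← Set.not_nonempty_iff_eq_empty]
    exact fun ⟨x, hx⟩ => hz ⟨x, face_subset_face_empty z J hx.2, hx.1⟩
  rw [this, h.map_empty, mul_zero]

open Classical in
/-- The grid cubes with corner coordinates below `m` which meet both `S` and its complement. -/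
def boundaryCells (m : ℕ) (S : Set (Euc n)) : Finset (Fin n → ℕ) :=
  {z ∈ Fintype.piFinset fun _ : Fin n => Finset.range m | (face z ∅ ∩ S).Nonempty ∧ ¬ face z ∅ ⊆ S}

lemma IsGridVal.norm_le_card (h : IsGridVal ψ) (h0 : cellSum ψ 0 Set.univ = 0) {B : ℝ}
    (hB : ∀ S, Convex ℝ S → IsCompact S → S ⊆ face 0 ∅ → ‖ψ S‖ ≤ B) (m : ℕ)
    {S : Set (Euc n)} (hc : Convex ℝ S) (hk : IsCompact S)
    (hS : ∀ x ∈ S, ∀ i, 0 < x i ∧ x i ≤ m) :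
    ‖ψ S‖ ≤ (boundaryCells m S).card * (2 ^ n * B) := by
  have hsub : boundaryCells m S ⊆ Fintype.piFinset fun _ : Fin n => Finset.range m := by
    classical exact fun z hz => (Finset.mem_filter.1 hz).1
  rw [h.eq_sum_cellSum m hc hk hS, ← Finset.sum_subset hsub, ← nsmul_eq_mul]
  · exact norm_sum_le_of_le _ (fun z _ => h.norm_cellSum_le hB hc hk z) |>.trans (by simp)
  · intro z hz hz'
    simp only [boundaryCells, Finset.mem_filter, hz, true_and, not_and, not_not] at hz'
    by_cases h₁ : (face z ∅ ∩ S).Nonempty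
    · rw [h.cellSum_of_subset (hz' h₁), h0]
    · exact h.cellSum_of_disjoint h₁

end Grid

section Counting

open MeasureTheory

variable {n : ℕ}

/-- The half-open unit grid cube with lowest corner `z`. -/
def halfOpenCell (z : Fin n → ℕ) : Set (Euc n) := {x | ∀ i, (z i : ℝ) ≤ x i ∧ x i < z i + 1}

lemma halfOpenCell_subset_face (z : Fin n → ℕ) : halfOpenCell z ⊆ face z ∅ :=
  fun _ hx i => ⟨(hx i).1, (hx i).2.le, by simp⟩

lemma neg_corner_vadd_halfOpenCell (z : Fin n → ℕ) :
    -corner z +ᵥ halfOpenCell z = halfOpenCell 0 := by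
  ext x
  rw [mem_neg_corner_vadd]
  simp [halfOpenCell, corner]

lemma measurableSet_halfOpenCell (z : Fin n → ℕ) : MeasurableSet (halfOpenCell z) := by
  have : halfOpenCell z = ⋂ i, {x : Euc n | (z i : ℝ) ≤ x i} ∩ {x | x i < z i + 1} := by
    ext x
    simp [halfOpenCell]
  rw [this]
  exact MeasurableSet.iInter fun i => (isClosed_coord_ge i _).measurableSet.inter
    (isOpen_lt (coord_continuous i) continuous_const).measurableSet

lemma volume_halfOpenCell (z : Fin n → ℕ) :
    volume (halfOpenCell z) = volume (halfOpenCell (0 : Fin n → ℕ)) := by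
  rw [← neg_corner_vadd_halfOpenCell z, measure_vadd]

lemma pairwise_disjoint_halfOpenCell :
    Pairwise (Function.onFun Disjoint (halfOpenCell (n := n))) := by
  intro z w hzw
  refine Set.disjoint_left.2 fun x hz hw => hzw (funext fun i => ?_)
  have h₁ : (z i : ℝ) < w i + 1 := (hz i).1.trans_lt (hw i).2
  have h₂ : (w i : ℝ) < z i + 1 := (hw i).1.trans_lt (hz i).2
  norm_cast at h₁ h₂
  omega

lemma volume_halfOpenCell_zero_pos : 0 < volume (halfOpenCell (0 : Fin n → ℕ)) := by
  have hopen : IsOpen (⋂ i, {x : Euc n | 0 < x i} ∩ {x | x i < 1}) :=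
    isOpen_iInter_of_finite fun i => (isOpen_lt continuous_const (coord_continuous i)).inter
      (isOpen_lt (coord_continuous i) continuous_const)
  refine (hopen.measure_pos volume ⟨WithLp.toLp 2 fun _ => 1 / 2, ?_⟩).trans_le
    (measure_mono fun x hx i => ?_)
  · simp; norm_num
  · simp only [Set.mem_iInter, Set.mem_inter_iff, Set.mem_ofPred_eq] at hx
    simpa using ⟨(hx i).1.le, (hx i).2⟩

lemma volume_halfOpenCell_zero_ne_top : volume (halfOpenCell (0 : Fin n → ℕ)) ≠ ⊤ :=
  ((measure_mono (halfOpenCell_subset_face 0)).trans_lt isCompact_face_zero.measure_lt_top).ne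

lemma dist_le_of_mem_face {z : Fin n → ℕ} {x y : Euc n} (hx : x ∈ face z ∅) (hy : y ∈ face z ∅) :
    dist x y ≤ Metric.diam (face (0 : Fin n → ℕ) ∅) := by
  rw [← dist_vadd_cancel_left (-corner z)]
  refine Metric.dist_le_diam_of_mem isCompact_face_zero.isBounded ?_ ?_ <;>
  rw [← neg_corner_vadd_face z] <;> exact Set.vadd_mem_vadd_set ‹_›

lemma inter_frontier_nonempty {X : Type*} [TopologicalSpace X] {Q S : Set X}
    (hQ : IsPreconnected Q) (hmeet : (Q ∩ S).Nonempty) (hsub : ¬ Q ⊆ S) :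
    (Q ∩ frontier S).Nonempty := by
  by_contra hcon
  rw [Set.not_nonempty_iff_eq_empty, ← Set.disjoint_iff_inter_eq_empty,
    Set.disjoint_left] at hcon
  obtain ⟨x, hxQ, hxS⟩ := hmeet
  refine hsub ((hQ.subset_left_of_subset_union isOpen_interior isClosed_closure.isOpen_compl
    (disjoint_compl_right.mono_left interior_subset_closure) (fun y hy => ?_)
    ⟨x, hxQ, ?_⟩).trans interior_subset)
  · by_contra h
    rw [Set.mem_union, Set.mem_compl_iff, not_or, not_not] at h
    exact hcon hy ⟨h.2, h.1⟩
  · by_contra h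
    exact hcon hxQ ⟨subset_closure hxS, h⟩

lemma halfOpenCell_subset_of_mem_boundaryCells {m N : ℕ} (hN : 0 < N) {S : Set (Euc n)}
    {z : Fin n → ℕ} (hz : z ∈ boundaryCells m ((N : ℝ) • S)) :
    halfOpenCell z ⊆
      (N : ℝ) • Metric.cthickening (Metric.diam (face (0 : Fin n → ℕ) ∅) / N) (frontier S) := by
  classical
  have hN' : (0 : ℝ) < N := by exact_mod_cast hN
  obtain ⟨-, hmeet, hsub⟩ := Finset.mem_filter.1 hz
  intro y hy
  have hfr : frontier ((N : ℝ) • S) = (N : ℝ) • frontier S :=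
    ((Homeomorph.smulOfNeZero (N : ℝ) hN'.ne').image_frontier S).symm
  have hne : (face z ∅ ∩ frontier ((N : ℝ) • S)).Nonempty := by
    exact inter_frontier_nonempty (convex_face z ∅).isPreconnected hmeet hsub
  obtain ⟨x, hxz, hx⟩ := hne
  rw [hfr] at hx
  obtain ⟨x, hx, rfl⟩ := hx
  refine ⟨(N : ℝ)⁻¹ • y, ?_, smul_inv_smul₀ hN'.ne' y⟩
  refine Metric.mem_cthickening_of_dist_le _ x _ _ hx ?_
  have hd := dist_le_of_mem_face (halfOpenCell_subset_face z hy) hxz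
  have : dist ((N : ℝ)⁻¹ • y) x = (N : ℝ)⁻¹ * dist y ((N : ℝ) • x) := by
    conv_lhs => rw [← inv_smul_smul₀ hN'.ne' x]
    rw [dist_smul₀, Real.norm_of_nonneg (inv_nonneg.2 hN'.le)]
  rw [this, div_eq_inv_mul]
  exact mul_le_mul_of_nonneg_left hd (inv_nonneg.2 hN'.le)

lemma card_boundaryCells_mul_le {m N : ℕ} (hN : 0 < N) {S : Set (Euc n)} (hS : IsCompact S) :
    (boundaryCells m ((N : ℝ) • S)).card * volume.real (halfOpenCell (0 : Fin n → ℕ)) ≤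
      (N : ℝ) ^ n * volume.real
        (Metric.cthickening (Metric.diam (face (0 : Fin n → ℕ) ∅) / N) (frontier S)) := by
  set A := Metric.cthickening (Metric.diam (face (0 : Fin n → ℕ) ∅) / N) (frontier S)
  have hA : volume ((N : ℝ) • A) ≠ ⊤ :=
    (((hS.isBounded.subset hS.isClosed.frontier_subset).cthickening).smul₀
      (N : ℝ)).measure_lt_top.ne
  calc _ = ∑ z ∈ boundaryCells m ((N : ℝ) • S), volume.real (halfOpenCell z) := by
        simp [Measure.real, volume_halfOpenCell]
    _ = volume.real (⋃ z ∈ boundaryCells m ((N : ℝ) • S), halfOpenCell z) :=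
        (measureReal_biUnion_finset (pairwise_disjoint_halfOpenCell.set_pairwise _)
          (fun z _ => measurableSet_halfOpenCell z) fun z _ => by
            rw [volume_halfOpenCell]
            exact volume_halfOpenCell_zero_ne_top).symm
    _ ≤ volume.real ((N : ℝ) • A) := measureReal_mono
        (Set.iUnion₂_subset fun z hz => halfOpenCell_subset_of_mem_boundaryCells hN hz) hA
    _ = _ := by
        rw [Measure.real, Measure.addHaar_smul, ENNReal.toReal_mul, finrank_euclideanSpace_fin,
          abs_of_nonneg (by positivity), ENNReal.toReal_ofReal (by positivity)]
        rfl

lemma tendsto_volume_cthickening_frontier {S : Set (Euc n)} (hc : Convex ℝ S) (hk : IsCompact S)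
    (R : ℝ) :
    Filter.Tendsto (fun N : ℕ => volume.real (Metric.cthickening (R / N) (frontier S)))
      Filter.atTop (nhds 0) := by
  have hf : IsCompact (frontier S) := hk.of_isClosed_subset isClosed_frontier
    hk.isClosed.frontier_subset
  have h := tendsto_measure_cthickening_of_isCompact (μ := volume) hf
  rw [hc.addHaar_frontier volume] at h
  have := (ENNReal.tendsto_toReal ENNReal.zero_ne_top).comp
    (h.comp (tendsto_const_div_atTop_nhds_zero_nat R))
  simpa [Function.comp_def, Measure.real] using this

lemma exists_corner_bound {S : Set (Euc n)} (hk : IsCompact S) :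
    ∃ (v : Euc n) (m : ℕ), ∀ x ∈ v +ᵥ S, ∀ i, 0 < x i ∧ x i ≤ m := by
  obtain ⟨R, hR⟩ := hk.isBounded.exists_norm_le
  obtain ⟨m, hm⟩ := exists_nat_ge (2 * R + 1)
  refine ⟨WithLp.toLp 2 fun _ => R + 1, m, ?_⟩
  rintro _ ⟨x, hx, rfl⟩ i
  have h := abs_le.1 ((PiLp.norm_apply_le x i).trans (hR x hx))
  simp only [vadd_eq_add, PiLp.add_apply]
  constructor <;> linarith [h.1, h.2]

variable {ψ : Set (Euc n) → ℂ}

lemma IsGridVal.eq_zero (h : IsGridVal ψ) (h0 : cellSum ψ 0 Set.univ = 0) {S : Set (Euc n)}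
    (hc : Convex ℝ S) (hk : IsCompact S) : ψ S = 0 := by
  obtain ⟨v, m, hm⟩ := exists_corner_bound hk
  rw [← h.trans S hc hk v]
  replace hc := hc.vadd v
  replace hk := hk.vadd v
  generalize v +ᵥ S = S at hm hc hk
  obtain ⟨B, hB0, hB⟩ := h.bdd
  set V := volume.real (halfOpenCell (0 : Fin n → ℕ)) with hV
  have hVpos : 0 < V :=
    ENNReal.toReal_pos volume_halfOpenCell_zero_pos.ne' volume_halfOpenCell_zero_ne_top
  have hlim := (tendsto_volume_cthickening_frontier hc hk
    (Metric.diam (face (0 : Fin n → ℕ) ∅))).const_mul (2 ^ n * B / V)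
  rw [mul_zero] at hlim
  refine norm_le_zero_iff.1 (ge_of_tendsto hlim ?_)
  filter_upwards [Filter.eventually_gt_atTop 0] with N hN
  have hN' : (0 : ℝ) < N := by exact_mod_cast hN
  have hbd := h.norm_le_card h0 hB (N * m) (hc.smul (N : ℝ)) (hk.smul (N : ℝ)) (by
    rintro _ ⟨x, hx, rfl⟩ i
    simp only [PiLp.smul_apply, smul_eq_mul, Nat.cast_mul]
    exact ⟨mul_pos hN' (hm x hx i).1, mul_le_mul_of_nonneg_left (hm x hx i).2 hN'.le⟩)
  rw [h.homog S hc hk N hN, norm_mul, norm_pow, Complex.norm_natCast] at hbd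
  have hcard := card_boundaryCells_mul_le (m := N * m) hN hk
  rw [← hV] at hcard
  have hcard' := mul_le_mul_of_nonneg_right hcard (by positivity : 0 ≤ 2 ^ n * B / V)
  have : (boundaryCells (N * m) ((N : ℝ) • S)).card * V * (2 ^ n * B / V)
      = (boundaryCells (N * m) ((N : ℝ) • S)).card * (2 ^ n * B) := by
    field_simp
  rw [this] at hcard'
  have hpow : (0 : ℝ) < (N : ℝ) ^ n := by positivity
  refine le_of_mul_le_mul_left (hbd.trans (hcard'.trans_eq ?_)) hpow
  ring

end Counting

section Valuations

open MeasureTheory TopologicalSpace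

variable {n : ℕ}

lemma isGridVal_volume : IsGridVal fun S : Set (Euc n) => ((volume.real S : ℝ) : ℂ) where
  map_empty := by simp
  cut S _ hk i t := by
    have hU : S ∩ {x | x i ≤ t} ∪ S ∩ {x | t ≤ x i} = S := by
      rw [← Set.inter_union_distrib_left, Set.inter_eq_left]
      exact fun x _ => le_total (x i) t
    have hI : S ∩ {x | x i ≤ t} ∩ (S ∩ {x | t ≤ x i}) = S ∩ {x | x i = t} := by
      rw [← Set.inter_inter_distrib_left]
      congr 1
      ext x
      exact (le_antisymm_iff (a := x i) (b := t)).symm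
    have h := measureReal_union_add_inter (μ := volume) (s := S ∩ {x : Euc n | x i ≤ t})
      (hk.inter_right (isClosed_coord_ge i t)).measurableSet
      (hk.inter_right (isClosed_coord_le i t)).measure_lt_top.ne
      (hk.inter_right (isClosed_coord_ge i t)).measure_lt_top.ne
    rw [hU, hI] at h
    rw [eq_sub_iff_add_eq]
    exact_mod_cast h
  trans S _ _ v := by simp [Measure.real, measure_vadd]
  bdd := ⟨volume.real (face (0 : Fin n → ℕ) ∅), measureReal_nonneg, fun S _ _ hS => by
    rw [Complex.norm_real, Real.norm_of_nonneg measureReal_nonneg]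
    exact measureReal_mono hS isCompact_face_zero.measure_lt_top.ne⟩
  homog S _ _ N _ := by
    rw [Measure.real, Measure.addHaar_smul, ENNReal.toReal_mul, finrank_euclideanSpace_fin,
      abs_of_nonneg (by positivity), ENNReal.toReal_ofReal (by positivity)]
    simp [Measure.real]

lemma IsGridVal.sub_const_mul {ψ θ : Set (Euc n) → ℂ} (hψ : IsGridVal ψ) (hθ : IsGridVal θ)
    (c : ℂ) : IsGridVal fun S => ψ S - c * θ S where
  map_empty := by simp [hψ.map_empty, hθ.map_empty]
  cut S hc hk i t := by
    rw [hψ.cut S hc hk i t, hθ.cut S hc hk i t]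
    ring
  trans S hc hk v := by rw [hψ.trans S hc hk, hθ.trans S hc hk]
  bdd := by
    obtain ⟨B, hB0, hB⟩ := hψ.bdd
    obtain ⟨C, hC0, hC⟩ := hθ.bdd
    refine ⟨B + ‖c‖ * C, by positivity, fun S hc hk hS => (norm_sub_le _ _).trans ?_⟩
    rw [norm_mul]
    exact add_le_add (hB S hc hk hS) (mul_le_mul_of_nonneg_left (hC S hc hk hS) (norm_nonneg c))
  homog S hc hk N hN := by
    rw [hψ.homog S hc hk N hN, hθ.homog S hc hk N hN]
    ring

lemma cellSum_sub_const_mul (ψ θ : Set (Euc n) → ℂ) (c : ℂ) (z : Fin n → ℕ) (S : Set (Euc n)) :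
    cellSum (fun S => ψ S - c * θ S) z S = cellSum ψ z S - c * cellSum θ z S := by
  simp only [cellSum, mul_sub, Finset.sum_sub_distrib, Finset.mul_sum]
  congr 1
  exact Finset.sum_congr rfl fun J _ => by ring

lemma cellSum_volume_ne_zero :
    cellSum (fun S : Set (Euc n) => ((volume.real S : ℝ) : ℂ)) 0 Set.univ ≠ 0 := by
  intro h
  have h' := isGridVal_volume.eq_zero h (convex_face (0 : Fin n → ℕ) ∅) isCompact_face_zero
  have hpos : 0 < volume.real (face (0 : Fin n → ℕ) ∅) :=
    ENNReal.toReal_pos (volume_halfOpenCell_zero_pos.trans_le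
      (measure_mono (halfOpenCell_subset_face 0))).ne' isCompact_face_zero.measure_lt_top.ne
  exact hpos.ne' (by exact_mod_cast h')

lemma IsGridVal.exists_eq_mul_volume {ψ : Set (Euc n) → ℂ} (h : IsGridVal ψ) :
    ∃ c : ℂ, ∀ S, Convex ℝ S → IsCompact S → ψ S = c * ((volume.real S : ℝ) : ℂ) := by
  refine ⟨cellSum ψ 0 Set.univ /
    cellSum (fun S : Set (Euc n) => ((volume.real S : ℝ) : ℂ)) 0 Set.univ, fun S hc hk => ?_⟩
  refine sub_eq_zero.1 ((h.sub_const_mul isGridVal_volume _).eq_zero ?_ hc hk)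
  rw [cellSum_sub_const_mul, div_mul_cancel₀ _ cellSum_volume_ne_zero, sub_self]

lemma isClosed_convex_nonemptyCompacts {V : Type*} [NormedAddCommGroup V] [NormedSpace ℝ V] :
    IsClosed {K : NonemptyCompacts V | Convex ℝ (K : Set V)} := by
  refine isClosed_of_closure_subset fun K hK => ?_
  intro x hx y hy a b ha hb hab
  rw [← K.isCompact.isClosed.closure_eq, Metric.mem_closure_iff]
  intro ε hε
  obtain ⟨L, hL, hKL⟩ := Metric.mem_closure_iff.1 hK (ε / 2) (half_pos hε)
  have hKL' : Metric.hausdorffDist (K : Set V) L < ε / 2 := hKL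
  have hfin : Metric.hausdorffEDist (K : Set V) L ≠ ⊤ :=
    Metric.hausdorffEDist_ne_top_of_nonempty_of_bounded K.nonempty L.nonempty
      K.isCompact.isBounded L.isCompact.isBounded
  obtain ⟨x', hx', hxx⟩ := Metric.exists_dist_lt_of_hausdorffDist_lt hx hKL' hfin
  obtain ⟨y', hy', hyy⟩ := Metric.exists_dist_lt_of_hausdorffDist_lt hy hKL' hfin
  obtain ⟨w, hw, hwz⟩ := Metric.exists_dist_lt_of_hausdorffDist_lt' (hL hx' hy' ha hb hab)
    hKL' hfin
  refine ⟨w, hw, ?_⟩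
  have h₁ : dist (a • x + b • y) (a • x' + b • y') ≤ ε / 2 := by
    calc dist (a • x + b • y) (a • x' + b • y')
        ≤ dist (a • x) (a • x') + dist (b • y) (b • y') := dist_add_add_le _ _ _ _
      _ = a * dist x x' + b * dist y y' := by
        rw [dist_smul₀, dist_smul₀, Real.norm_of_nonneg ha, Real.norm_of_nonneg hb]
      _ ≤ a * (ε / 2) + b * (ε / 2) :=
        add_le_add (mul_le_mul_of_nonneg_left hxx.le ha) (mul_le_mul_of_nonneg_left hyy.le hb)
      _ = ε / 2 := by rw [← add_mul, hab, one_mul]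
  have := dist_triangle (a • x + b • y) (a • x' + b • y') w
  rw [dist_comm] at hwz
  linarith

/-- Blaschke's selection theorem. -/
lemma isCompact_convexBody_subset {V : Type*} [NormedAddCommGroup V] [NormedSpace ℝ V]
    {Q : Set V} (hQ : IsCompact Q) : IsCompact {K : ConvexBody V | (K : Set V) ⊆ Q} := by
  let f : ConvexBody V → NonemptyCompacts V := fun K => ⟨⟨K, K.isCompact⟩, K.nonempty⟩
  have hf : Isometry f := Isometry.of_dist_eq fun K L => rfl
  rw [hf.isEmbedding.isCompact_iff]
  have : f '' {K : ConvexBody V | (K : Set V) ⊆ Q} =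
      {K : NonemptyCompacts V | (K : Set V) ⊆ Q} ∩
        {K : NonemptyCompacts V | Convex ℝ (K : Set V)} := by
    ext K
    constructor
    · rintro ⟨L, hL, rfl⟩
      exact ⟨hL, L.convex⟩
    · rintro ⟨h₁, h₂⟩
      exact ⟨⟨K, h₂, K.isCompact, K.nonempty⟩, h₁, rfl⟩
  rw [this]
  exact (NonemptyCompacts.isCompact_subsets_of_isCompact hQ).inter_right
    isClosed_convex_nonemptyCompacts

open Classical in
/-- The extension by zero of a function on convex bodies to all sets. -/
def extendZero (φ : CB n → ℂ) (S : Set (Euc n)) : ℂ :=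
  if h : Convex ℝ S ∧ IsCompact S ∧ S.Nonempty then φ ⟨S, h.1, h.2.1, h.2.2⟩ else 0

lemma extendZero_coe (φ : CB n → ℂ) (K : CB n) : extendZero φ K = φ K :=
  dif_pos ⟨K.convex, K.isCompact, K.nonempty⟩

lemma extendZero_empty (φ : CB n → ℂ) : extendZero φ ∅ = 0 :=
  dif_neg fun h => Set.not_nonempty_empty h.2.2

lemma eq_empty_or_exists_convexBody {S : Set (Euc n)} (hc : Convex ℝ S) (hk : IsCompact S) :
    S = ∅ ∨ ∃ K : CB n, (K : Set (Euc n)) = S :=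
  S.eq_empty_or_nonempty.imp id fun h => ⟨⟨S, hc, hk, h⟩, rfl⟩

lemma extendZero_cut {φ : CB n → ℂ} (hφ : IsVal φ) {S : Set (Euc n)} (hc : Convex ℝ S)
    (hk : IsCompact S) (i : Fin n) (t : ℝ) :
    extendZero φ S = extendZero φ (S ∩ {x | x i ≤ t}) + extendZero φ (S ∩ {x | t ≤ x i})
      - extendZero φ (S ∩ {x | x i = t}) := by
  have hU : S ∩ {x | x i ≤ t} ∪ S ∩ {x | t ≤ x i} = S := by
    rw [← Set.inter_union_distrib_left, Set.inter_eq_left]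
    exact fun x _ => le_total (x i) t
  have hI : S ∩ {x | x i ≤ t} ∩ (S ∩ {x | t ≤ x i}) = S ∩ {x | x i = t} := by
    rw [← Set.inter_inter_distrib_left]
    congr 1
    ext x
    exact (le_antisymm_iff (a := x i) (b := t)).symm
  have hc₁ := hc.inter (convex_coord_le i t)
  have hc₂ := hc.inter (convex_coord_ge i t)
  have hk₁ := hk.inter_right (isClosed_coord_le i t)
  have hk₂ := hk.inter_right (isClosed_coord_ge i t)
  have hc₃ := hc₁.inter hc₂
  have hk₃ := hk₁.inter hk₂
  rw [← hI]
  generalize S ∩ {x | x i ≤ t} = A at *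
  generalize S ∩ {x | t ≤ x i} = B at *
  rcases eq_empty_or_exists_convexBody hc₁ hk₁ with rfl | ⟨A, rfl⟩
  · rw [Set.empty_union] at hU
    rw [Set.empty_inter, hU, extendZero_empty]
    ring
  rcases eq_empty_or_exists_convexBody hc₂ hk₂ with rfl | ⟨B, rfl⟩
  · rw [Set.union_empty] at hU
    rw [Set.inter_empty, hU, extendZero_empty]
    ring
  rcases eq_empty_or_exists_convexBody hc hk with rfl | ⟨U, rfl⟩
  · exact absurd (hU ▸ A.nonempty.inl) Set.not_nonempty_empty
  have hI' : ((A : Set (Euc n)) ∩ B).Nonempty :=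
    isPreconnected_closed_iff.1 U.convex.isPreconnected _ _ A.isClosed B.isClosed hU.ge
      (by rw [← hU, Set.union_inter_cancel_left]; exact A.nonempty)
      (by rw [← hU, Set.union_inter_cancel_right]; exact B.nonempty) |>.mono
        Set.inter_subset_right
  obtain ⟨I, hI⟩ : ∃ I : CB n, (I : Set (Euc n)) = (A : Set (Euc n)) ∩ B := ⟨⟨_, hc₃, hk₃, hI'⟩, rfl⟩
  rw [← hI]
  simp only [extendZero_coe]
  exact hφ A B U I hU.symm hI

lemma isGridVal_extendZero {φ : CB n → ℂ} (hφ : GoodVal φ) (hhom : Homog n φ) :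
    IsGridVal (extendZero φ) where
  map_empty := extendZero_empty φ
  cut S hc hk i t := extendZero_cut hφ.1 hc hk i t
  trans S hc hk v := by
    rcases eq_empty_or_exists_convexBody hc hk with rfl | ⟨K, rfl⟩
    · rw [Set.vadd_set_empty]
    · obtain ⟨L, hL⟩ : ∃ L : CB n, (L : Set (Euc n)) = v +ᵥ (K : Set (Euc n)) :=
        ⟨⟨_, hc.vadd v, hk.vadd v, K.nonempty.vadd_set⟩, rfl⟩
      rw [← hL, extendZero_coe, extendZero_coe, hφ.2.2 K L v hL]
  bdd := by
    obtain ⟨B, hB⟩ := (isCompact_convexBody_subset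
      (isCompact_face_zero (n := n))).exists_bound_of_continuousOn hφ.2.1.continuousOn
    refine ⟨max B 0, le_max_right _ _, fun S hc hk hS => ?_⟩
    rcases eq_empty_or_exists_convexBody hc hk with rfl | ⟨K, rfl⟩
    · rw [extendZero_empty, norm_zero]
      exact le_max_right _ _
    · rw [extendZero_coe]
      exact (hB K hS).trans (le_max_left _ _)
  homog S hc hk N hN := by
    rcases eq_empty_or_exists_convexBody hc hk with rfl | ⟨K, rfl⟩
    · rw [Set.smul_set_empty, extendZero_empty, mul_zero]
    · rw [← ConvexBody.coe_smul, extendZero_coe, extendZero_coe, hhom N (by exact_mod_cast hN)]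
      simp

end Valuations

/-- **Hadwiger**: `Valₙ(V)` is one dimensional, spanned by the Lebesgue measure: an
`n`-homogeneous translation invariant continuous convex valuation on `ℝⁿ` is a constant
multiple of the Lebesgue volume. -/
theorem val_top_homogeneous_is_volume {n : ℕ} (hn : 1 ≤ n) (φ : CB n → ℂ)
    (hφ : GoodVal φ) (hhom : Homog n φ) :
    ∃ c : ℂ, ∀ K : CB n,
      φ K = c * ((MeasureTheory.volume (K : Set (Euc n))).toReal : ℂ) := by
  obtain ⟨c, hc⟩ := (isGridVal_extendZero hφ hhom).exists_eq_mul_volume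
  exact ⟨c, fun K => by rw [← extendZero_coe φ K, hc K K.convex K.isCompact,
    MeasureTheory.Measure.real]⟩
end
end

section
/- (McMullen) Let n ≥ 1, let φ be a translation invariant continuous convex valuation on ℝⁿ, let K ∈ 𝒦(ℝⁿ), and let D be the closed Euclidean unit ball of ℝⁿ. Then the function ε ↦ φ(K + ε·D) on ε ≥ 0 is a polynomial in ε of degree at most n: there exist c₀, c₁, …, cₙ ∈ ℂ such that φ(K + ε·D) = Σ_{j=0}^{n} c_j εʲ for all ε ≥ 0, where K + ε·D denotes the Minkowski sum. -/
open scoped Pointwise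

noncomputable section

/-- The closed Euclidean unit ball of `ℝⁿ` as a convex body. -/
def unitBallCB (n : ℕ) : CB n :=
  ⟨Metric.closedBall 0 1, convex_closedBall 0 1, isCompact_closedBall 0 1,
    Metric.nonempty_closedBall.2 zero_le_one⟩

open Set Filter Topology

/-- The segment from `0` to `v` as a convex body. -/
def segBody {n : ℕ} (v : Euc n) : CB n :=
  ⟨(fun t : ℝ => t • v) '' Icc 0 1,
    (convex_Icc (0 : ℝ) 1).is_linear_image (IsLinearMap.mk (fun x y => add_smul x y v)
      (fun c x => mul_smul c x v)),
    isCompact_Icc.image (by fun_prop), (nonempty_Icc.2 zero_le_one).image _⟩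

lemma coe_segBody {n : ℕ} (v : Euc n) :
    (segBody v : Set (Euc n)) = (fun t : ℝ => t • v) '' Icc 0 1 := rfl

lemma mem_add_body {n : ℕ} {K L : CB n} {x : Euc n} :
    x ∈ (K + L : CB n) ↔ ∃ k ∈ K, ∃ l ∈ L, k + l = x := Iff.rfl

lemma mem_segBody {n : ℕ} {v x : Euc n} :
    x ∈ segBody v ↔ ∃ t : ℝ, (0 ≤ t ∧ t ≤ 1) ∧ t • v = x := Iff.rfl

lemma mem_add_segBody {n : ℕ} {K : CB n} {v x : Euc n} :
    x ∈ (K + segBody v : CB n) ↔ ∃ k ∈ K, ∃ t : ℝ, (0 ≤ t ∧ t ≤ 1) ∧ k + t • v = x := by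
  simp only [mem_add_body, mem_segBody]
  constructor
  · rintro ⟨k, hk, _, ⟨t, ht, rfl⟩, rfl⟩
    exact ⟨k, hk, t, ht, rfl⟩
  · rintro ⟨k, hk, t, ht, rfl⟩
    exact ⟨k, hk, _, ⟨t, ht, rfl⟩, rfl⟩

lemma segBody_zero {n : ℕ} : segBody (0 : Euc n) = 0 := by
  apply ConvexBody.ext
  simp [coe_segBody, (nonempty_Icc.2 (zero_le_one (α := ℝ))).image_const]
  rfl

lemma smul_segBody {n : ℕ} (c : ℝ) (v : Euc n) : c • segBody v = segBody (c • v) := by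
  apply ConvexBody.ext
  rw [ConvexBody.coe_smul, coe_segBody, coe_segBody, ← Set.image_smul, Set.image_image]
  simp only [smul_comm c]

/-- A linear image commutes with the intersection of two closed sets whose union is convex. -/
lemma image_inter_of_convex_union {E F : Type*} [AddCommGroup E] [Module ℝ E]
    [TopologicalSpace E] [IsTopologicalAddGroup E] [ContinuousSMul ℝ E]
    [AddCommGroup F] [Module ℝ F] (f : E →ₗ[ℝ] F) {S T : Set E}
    (hS : IsClosed S) (hT : IsClosed T) (hST : Convex ℝ (S ∪ T)) :
    f '' (S ∩ T) = f '' S ∩ f '' T := by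
  refine (image_inter_subset f S T).antisymm ?_
  rintro _ ⟨⟨s, hs, rfl⟩, t, ht, hts⟩
  have hseg : segment ℝ s t ⊆ S ∪ T := hST.segment_subset (Or.inl hs) (Or.inr ht)
  obtain ⟨y, hy, hyST⟩ := isPreconnected_closed_iff.1 (convex_segment s t).isPreconnected
    S T hS hT hseg ⟨s, left_mem_segment ℝ s t, hs⟩ ⟨t, right_mem_segment ℝ s t, ht⟩
  refine ⟨y, hyST, ?_⟩
  obtain ⟨a, b, -, -, hab, rfl⟩ := hy
  rw [map_add, map_smul, map_smul, hts, ← add_smul, hab, one_smul]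

/-- Valuation identity for bodies presented as linear images. -/
lemma IsVal.image {n : ℕ} {φ : CB n → ℂ} (hφ : IsVal φ) {E : Type*} [AddCommGroup E]
    [Module ℝ E] [TopologicalSpace E] [IsTopologicalAddGroup E] [ContinuousSMul ℝ E]
    (f : E →ₗ[ℝ] Euc n) {S T : Set E} (hS : IsClosed S) (hT : IsClosed T)
    (hST : Convex ℝ (S ∪ T)) {A B U I : CB n} (hA : (A : Set (Euc n)) = f '' S)
    (hB : (B : Set (Euc n)) = f '' T) (hU : (U : Set (Euc n)) = f '' (S ∪ T))
    (hI : (I : Set (Euc n)) = f '' (S ∩ T)) : φ U = φ A + φ B - φ I := by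
  apply hφ A B U I
  · rw [hU, hA, hB, image_union]
  · rw [hI, hA, hB, image_inter_of_convex_union f hS hT hST]

lemma dist_le_of_forall {n : ℕ} {K L : CB n} {r : ℝ} (hr : 0 ≤ r)
    (h₁ : ∀ x ∈ K, ∃ y ∈ L, dist x y ≤ r) (h₂ : ∀ x ∈ L, ∃ y ∈ K, dist x y ≤ r) :
    dist K L ≤ r :=
  Metric.hausdorffDist_le_of_mem_dist hr h₁ h₂

lemma exists_dist_lt {n : ℕ} {K L : CB n} {r : ℝ} (h : dist K L < r) {x : Euc n} (hx : x ∈ K) :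
    ∃ y ∈ L, dist x y < r :=
  Metric.exists_dist_lt_of_hausdorffDist_lt (s := (K : Set (Euc n))) hx h
    ConvexBody.hausdorffEDist_ne_top

lemma dist_add_right_body_le {n : ℕ} (K L M : CB n) : dist (K + M) (L + M) ≤ dist K L := by
  refine le_of_forall_gt_imp_ge_of_dense fun r hr => ?_
  have aux : ∀ K L : CB n, dist K L < r → ∀ x ∈ K + M, ∃ y ∈ L + M, dist x y ≤ r := by
    rintro K L hr _ ⟨k, hk, m, hm, rfl⟩
    obtain ⟨l, hl, hkl⟩ := exists_dist_lt hr hk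
    refine ⟨l + m, ⟨l, hl, m, hm, rfl⟩, ?_⟩
    simpa using hkl.le
  exact dist_le_of_forall (dist_nonneg.trans hr.le) (aux K L hr) (aux L K (dist_comm K L ▸ hr))

lemma dist_segBody_smul_le {n : ℕ} (v : Euc n) (s t : ℝ) :
    dist (segBody (s • v)) (segBody (t • v)) ≤ |s - t| * ‖v‖ := by
  have aux : ∀ s t : ℝ, ∀ x ∈ segBody (s • v), ∃ y ∈ segBody (t • v),
      dist x y ≤ |s - t| * ‖v‖ := by
    rintro s t _ ⟨a, ha, rfl⟩
    refine ⟨_, ⟨a, ha, rfl⟩, ?_⟩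
    rw [dist_eq_norm]
    simp only
    rw [← smul_sub, ← sub_smul, norm_smul, norm_smul, Real.norm_eq_abs, Real.norm_eq_abs,
      abs_of_nonneg ha.1]
    exact mul_le_of_le_one_left (by positivity) ha.2
  refine dist_le_of_forall (by positivity) (aux s t) ?_
  rw [abs_sub_comm]
  exact aux t s

/-- The difference of a functional along a segment. -/
def segDiff {n : ℕ} (v : Euc n) (φ : CB n → ℂ) (K : CB n) : ℂ := φ (K + segBody v) - φ K

lemma IsVal.add_right {n : ℕ} {φ : CB n → ℂ} (hφ : IsVal φ) (M : CB n) :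
    IsVal fun K => φ (K + M) := by
  intro A B U I hU hI
  have key : ∀ L : CB n, ((L + M : CB n) : Set (Euc n)) =
      (LinearMap.fst ℝ (Euc n) (Euc n) + LinearMap.snd ℝ (Euc n) (Euc n)) ''
        ((L : Set (Euc n)) ×ˢ (M : Set (Euc n))) := by
    intro L
    rw [ConvexBody.coe_add, ← Set.add_image_prod]
    rfl
  refine hφ.image (LinearMap.fst ℝ (Euc n) (Euc n) + LinearMap.snd ℝ (Euc n) (Euc n))
    (A.isClosed.prod M.isClosed) (B.isClosed.prod M.isClosed) ?_ (key A) (key B) ?_ ?_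
  · rw [← union_prod, ← hU]
    exact U.convex.prod M.convex
  · rw [key U, ← union_prod, ← hU]
  · rw [key I, prod_inter_prod, inter_self, ← hI]

lemma TransInv.add_right {n : ℕ} {φ : CB n → ℂ} (hφ : TransInv φ) (M : CB n) :
    TransInv fun K => φ (K + M) := by
  intro K L x h
  refine hφ _ _ x ?_
  rw [ConvexBody.coe_add, ConvexBody.coe_add, h, vadd_add_assoc]

lemma GoodVal.goodVal_segDiff {n : ℕ} {φ : CB n → ℂ} (hφ : GoodVal φ) (v : Euc n) :
    GoodVal (segDiff v φ) := by
  obtain ⟨hv, hc, ht⟩ := hφ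
  refine ⟨?_, ?_, ?_⟩
  · intro A B U I hU hI
    have h₁ := hv A B U I hU hI
    have h₂ := hv.add_right (segBody v) A B U I hU hI
    simp only at h₂
    simp only [segDiff, h₁, h₂]
    ring
  · have : Continuous fun K : CB n => K + segBody v :=
      (LipschitzWith.of_dist_le_mul (K := 1) fun K L => by
        simpa using dist_add_right_body_le K L (segBody v)).continuous
    exact (hc.comp this).sub hc
  · intro K L x h
    have h₂ := ht.add_right (segBody v) K L x h
    simp only at h₂
    simp only [segDiff, ht K L x h, h₂]

lemma segDiff_comm {n : ℕ} (u v : Euc n) (φ : CB n → ℂ) :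
    segDiff u (segDiff v φ) = segDiff v (segDiff u φ) := by
  ext K
  simp only [segDiff, add_right_comm K (segBody u)]
  ring

lemma segDiff_zero_left {n : ℕ} (φ : CB n → ℂ) : segDiff 0 φ = 0 := by
  ext K
  simp [segDiff, segBody_zero]

lemma segDiff_zero_right {n : ℕ} (v : Euc n) : segDiff v (0 : CB n → ℂ) = 0 := by
  ext K
  simp [segDiff]

/-- The translate of a convex body. -/
def translateBody {n : ℕ} (x : Euc n) (K : CB n) : CB n :=
  ⟨x +ᵥ (K : Set (Euc n)), K.convex.vadd x, K.isCompact.vadd x, K.nonempty.vadd_set⟩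

lemma mem_translateBody {n : ℕ} {x y : Euc n} {K : CB n} :
    y ∈ translateBody x K ↔ ∃ k ∈ K, x + k = y := Iff.rfl

lemma TransInv.apply_translateBody {n : ℕ} {φ : CB n → ℂ} (hφ : TransInv φ) (x : Euc n) (K : CB n) :
    φ (translateBody x K) = φ K :=
  hφ _ _ x rfl

lemma mem_add_segBody_smul {n : ℕ} {K : CB n} {v x : Euc n} {a : ℝ} (ha : 0 ≤ a) :
    x ∈ K + segBody (a • v) ↔ ∃ k ∈ K, ∃ c : ℝ, (0 ≤ c ∧ c ≤ a) ∧ k + c • v = x := by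
  rw [mem_add_segBody]
  constructor
  · rintro ⟨k, hk, c, hc, rfl⟩
    exact ⟨k, hk, c * a, ⟨mul_nonneg hc.1 ha, mul_le_of_le_one_left ha hc.2⟩,
      by rw [mul_smul]⟩
  · rintro ⟨k, hk, c, hc, rfl⟩
    rcases ha.eq_or_lt with rfl | ha
    · exact ⟨k, hk, 0, by simp, by simp [le_antisymm hc.2 hc.1]⟩
    · exact ⟨k, hk, c / a, ⟨div_nonneg hc.1 ha.le, (div_le_one ha).2 hc.2⟩, by
        rw [smul_smul, div_mul_cancel₀ _ ha.ne']⟩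

/-- Splitting a segment into two consecutive ones. -/
lemma GoodVal.add_segBody_add {n : ℕ} {φ : CB n → ℂ} (hφ : GoodVal φ) (K : CB n) (v : Euc n)
    {s t : ℝ} (hs : 0 ≤ s) (ht : 0 ≤ t) :
    φ (K + segBody ((s + t) • v)) =
      φ (K + segBody (s • v)) + φ (K + segBody (t • v)) - φ K := by
  let f : Euc n × ℝ →ₗ[ℝ] Euc n :=
    LinearMap.fst ℝ _ _ + (LinearMap.snd ℝ (Euc n) ℝ).smulRight v
  have hunion : Icc 0 s ∪ Icc s (s + t) = Icc 0 (s + t) :=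
    Icc_union_Icc_eq_Icc hs (by linarith)
  have hmem : ∀ (P : Set ℝ) (x : Euc n), x ∈ f '' ((K : Set (Euc n)) ×ˢ P) ↔
      ∃ k ∈ K, ∃ c ∈ P, k + c • v = x := by
    intro P x
    constructor
    · rintro ⟨⟨k, c⟩, ⟨hk, hc⟩, rfl⟩
      exact ⟨k, hk, c, hc, rfl⟩
    · rintro ⟨k, hk, c, hc, rfl⟩
      exact ⟨⟨k, c⟩, ⟨hk, hc⟩, rfl⟩
  have := hφ.1.image f (S := (K : Set (Euc n)) ×ˢ Icc 0 s)
    (T := (K : Set (Euc n)) ×ˢ Icc s (s + t)) (A := K + segBody (s • v))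
    (B := translateBody (s • v) (K + segBody (t • v))) (U := K + segBody ((s + t) • v))
    (I := translateBody (s • v) K)
    (K.isClosed.prod isClosed_Icc) (K.isClosed.prod isClosed_Icc) ?_ ?_ ?_ ?_ ?_
  · rw [this, hφ.2.2.apply_translateBody, hφ.2.2.apply_translateBody]
  · rw [← prod_union, hunion]
    exact K.convex.prod (convex_Icc _ _)
  · ext x
    rw [hmem]
    exact mem_add_segBody_smul hs
  · ext x
    rw [hmem, SetLike.mem_coe, mem_translateBody]
    constructor
    · rintro ⟨y, hy, rfl⟩
      obtain ⟨k, hk, c, hc, rfl⟩ := (mem_add_segBody_smul ht).1 hy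
      exact ⟨k, hk, s + c, ⟨by linarith [hc.1], by linarith [hc.2]⟩, by module⟩
    · rintro ⟨k, hk, c, hc, rfl⟩
      refine ⟨k + (c - s) • v, (mem_add_segBody_smul ht).2
        ⟨k, hk, c - s, ⟨by linarith [hc.1], by linarith [hc.2]⟩, rfl⟩, by module⟩
  · ext x
    rw [← prod_union, hunion, hmem]
    exact mem_add_segBody_smul (by positivity)
  · ext x
    rw [prod_inter_prod, inter_self, Icc_inter_Icc_eq_singleton hs (by linarith), hmem,
      SetLike.mem_coe, mem_translateBody]
    simp [add_comm]

/-- An additive function on `[0, ∞)` that is continuous is linear. -/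
lemma eq_mul_of_additive_nonneg {g : ℝ → ℂ} (hc : Continuous g)
    (hadd : ∀ s t, 0 ≤ s → 0 ≤ t → g (s + t) = g s + g t) {t : ℝ} (ht : 0 ≤ t) :
    g t = t * g 1 := by
  have h0 : g 0 = 0 := by simpa using hadd 0 0 le_rfl le_rfl
  let h : ℝ →+ ℂ :=
    { toFun := fun t => g (max t 0) - g (max (-t) 0)
      map_zero' := by simp
      map_add' := by
        intro s t
        have e : max (s + t) 0 + (max (-s) 0 + max (-t) 0) =
            max (-(s + t)) 0 + (max s 0 + max t 0) := by
          have aux : ∀ x : ℝ, max x 0 = max (-x) 0 + x := fun x => by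
            rcases le_total x 0 with hx | hx <;> simp [hx]
          linarith [aux s, aux t, aux (s + t)]
        have e' := congrArg g e
        rw [hadd _ _ (le_max_right _ _) (by positivity), hadd _ _ (by positivity) (by positivity),
          hadd _ _ (by positivity) (by positivity), hadd _ _ (by positivity) (by positivity)] at e'
        linear_combination e' }
  have hh : Continuous h := by
    change Continuous fun t => g (max t 0) - g (max (-t) 0)
    fun_prop
  have key := map_real_smul h hh t 1
  have hpos : ∀ t, 0 ≤ t → h t = g t := fun t ht => by
    change g (max t 0) - g (max (-t) 0) = g t
    rw [max_eq_left ht, max_eq_right (by linarith), h0, sub_zero]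
  rw [smul_eq_mul, mul_one, hpos t ht, hpos 1 zero_le_one] at key
  simpa using key

lemma GoodVal.add_segBody_smul {n : ℕ} {φ : CB n → ℂ} (hφ : GoodVal φ) (K : CB n) (v : Euc n)
    {t : ℝ} (ht : 0 ≤ t) :
    φ (K + segBody (t • v)) = φ K + t * segDiff v φ K := by
  have hc : Continuous fun t : ℝ => K + segBody (t • v) := by
    refine (LipschitzWith.of_dist_le_mul (K := ‖v‖₊) fun s t => ?_).continuous
    rw [add_comm K, add_comm K, coe_nnnorm, mul_comm, Real.dist_eq]
    exact (dist_add_right_body_le _ _ _).trans (dist_segBody_smul_le v s t)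
  have := eq_mul_of_additive_nonneg (g := fun t => φ (K + segBody (t • v)) - φ K)
    ((hφ.2.1.comp hc).sub continuous_const)
    (fun s t hs ht => by simp only [hφ.add_segBody_add K v hs ht]; ring) ht
  simp only [one_smul] at this
  rw [segDiff, ← this]
  ring

lemma GoodVal.segDiff_smul {n : ℕ} {φ : CB n → ℂ} (hφ : GoodVal φ) (v : Euc n)
    {t : ℝ} (ht : 0 ≤ t) : segDiff (t • v) φ = fun K => t * segDiff v φ K := by
  ext K
  rw [segDiff, hφ.add_segBody_smul K v ht]
  ring

/-- Shear invariance: a parallelogram can be cut along a diagonal and reassembled. -/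
lemma GoodVal.segDiff_add_segDiff {n : ℕ} {φ : CB n → ℂ} (hφ : GoodVal φ) (u v : Euc n) :
    segDiff (u + v) (segDiff u φ) = segDiff v (segDiff u φ) := by
  ext K
  let f : Euc n × ℝ × ℝ →ₗ[ℝ] Euc n :=
    LinearMap.fst ℝ _ _ + ((LinearMap.fst ℝ ℝ ℝ).comp (LinearMap.snd ℝ (Euc n) _)).smulRight u +
      ((LinearMap.snd ℝ ℝ ℝ).comp (LinearMap.snd ℝ (Euc n) _)).smulRight v
  have hfc : Continuous f := by
    change Continuous fun p : Euc n × ℝ × ℝ => p.1 + p.2.1 • u + p.2.2 • v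
    fun_prop
  have hmem : ∀ (P : Set (ℝ × ℝ)) (x : Euc n), x ∈ f '' ((K : Set (Euc n)) ×ˢ P) ↔
      ∃ k ∈ K, ∃ a b : ℝ, (a, b) ∈ P ∧ k + a • u + b • v = x := by
    intro P x
    constructor
    · rintro ⟨⟨k, a, b⟩, ⟨hk, hc⟩, rfl⟩
      exact ⟨k, hk, a, b, hc, rfl⟩
    · rintro ⟨k, hk, a, b, hc, rfl⟩
      exact ⟨⟨k, a, b⟩, ⟨hk, hc⟩, rfl⟩
  let P₁ : Set (ℝ × ℝ) := {q | 0 ≤ q.2 ∧ q.2 ≤ q.1 ∧ q.1 ≤ 1}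
  let P₂ : Set (ℝ × ℝ) := {q | 0 ≤ q.1 ∧ q.1 ≤ q.2 ∧ q.2 ≤ 1}
  let P₃ : Set (ℝ × ℝ) := {q | 1 ≤ q.1 ∧ q.1 ≤ q.2 + 1 ∧ q.2 ≤ 1}
  have c₁ : IsClosed P₁ := by
    simp only [P₁, ofPred_and]
    exact (isClosed_le (by fun_prop) (by fun_prop)).inter
      ((isClosed_le (by fun_prop) (by fun_prop)).inter (isClosed_le (by fun_prop) (by fun_prop)))
  have c₂ : IsClosed P₂ := by
    simp only [P₂, ofPred_and]
    exact (isClosed_le (by fun_prop) (by fun_prop)).inter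
      ((isClosed_le (by fun_prop) (by fun_prop)).inter (isClosed_le (by fun_prop) (by fun_prop)))
  have c₃ : IsClosed P₃ := by
    simp only [P₃, ofPred_and]
    exact (isClosed_le (by fun_prop) (by fun_prop)).inter
      ((isClosed_le (by fun_prop) (by fun_prop)).inter (isClosed_le (by fun_prop) (by fun_prop)))
  have k₁ : IsCompact P₁ := (isCompact_Icc (a := ((0, 0) : ℝ × ℝ)) (b := (1, 1))).of_isClosed_subset
    c₁ fun q hq => ⟨⟨hq.1.trans hq.2.1, hq.1⟩, ⟨hq.2.2, hq.2.1.trans hq.2.2⟩⟩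
  have k₂ : IsCompact P₂ := (isCompact_Icc (a := ((0, 0) : ℝ × ℝ)) (b := (1, 1))).of_isClosed_subset
    c₂ fun q hq => ⟨⟨hq.1, hq.1.trans hq.2.1⟩, ⟨hq.2.1.trans hq.2.2, hq.2.2⟩⟩
  have v₁ : Convex ℝ P₁ := by
    rintro ⟨x, y⟩ ⟨h1, h2, h3⟩ ⟨x', y'⟩ ⟨h1', h2', h3'⟩ a b ha hb hab
    simp only at *
    refine ⟨?_, ?_, ?_⟩ <;> simp <;> nlinarith
  have v₂ : Convex ℝ P₂ := by
    rintro ⟨x, y⟩ ⟨h1, h2, h3⟩ ⟨x', y'⟩ ⟨h1', h2', h3'⟩ a b ha hb hab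
    simp only at *
    refine ⟨?_, ?_, ?_⟩ <;> simp <;> nlinarith
  have u₁₂ : P₁ ∪ P₂ = {q | (0 ≤ q.1 ∧ q.1 ≤ 1) ∧ 0 ≤ q.2 ∧ q.2 ≤ 1} := by
    ext ⟨x, y⟩
    simp only [P₁, P₂, mem_union, mem_ofPred_eq]
    grind
  have u₁₃ : P₁ ∪ P₃ = {q | (q.2 ≤ q.1 ∧ q.1 ≤ q.2 + 1) ∧ 0 ≤ q.2 ∧ q.2 ≤ 1} := by
    ext ⟨x, y⟩
    simp only [P₁, P₃, mem_union, mem_ofPred_eq]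
    grind
  let T₁ : CB n := ⟨f '' ((K : Set (Euc n)) ×ˢ P₁), (K.convex.prod v₁).linear_image f,
    (K.isCompact.prod k₁).image hfc, (K.nonempty.prod ⟨(0, 0), by simp [P₁]⟩).image f⟩
  let T₂ : CB n := ⟨f '' ((K : Set (Euc n)) ×ˢ P₂), (K.convex.prod v₂).linear_image f,
    (K.isCompact.prod k₂).image hfc, (K.nonempty.prod ⟨(0, 0), by simp [P₂]⟩).image f⟩
  have e₁ : φ (K + segBody v + segBody u) = φ T₁ + φ T₂ - φ (K + segBody (u + v)) := by
    refine hφ.1.image f (K.isClosed.prod c₁) (K.isClosed.prod c₂) ?_ rfl rfl ?_ ?_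
    · rw [← prod_union, u₁₂]
      refine K.convex.prod ?_
      rintro ⟨x, y⟩ ⟨⟨h1, h2⟩, h3, h4⟩ ⟨x', y'⟩ ⟨⟨h1', h2'⟩, h3', h4'⟩ a b ha hb hab
      simp only at *
      refine ⟨⟨?_, ?_⟩, ?_, ?_⟩ <;> simp <;> nlinarith
    · ext x
      rw [← prod_union, hmem, u₁₂, SetLike.mem_coe, mem_add_segBody]
      simp only [mem_add_segBody, mem_ofPred_eq]
      constructor
      · rintro ⟨_, ⟨k, hk, b, hb, rfl⟩, a, ha, rfl⟩
        exact ⟨k, hk, a, b, ⟨ha, hb⟩, by module⟩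
      · rintro ⟨k, hk, a, b, ⟨ha, hb⟩, rfl⟩
        exact ⟨_, ⟨k, hk, b, hb, rfl⟩, a, ha, by module⟩
    · ext x
      rw [prod_inter_prod, inter_self, hmem, SetLike.mem_coe, mem_add_segBody]
      constructor
      · rintro ⟨k, hk, a, ha, rfl⟩
        exact ⟨k, hk, a, a, ⟨⟨ha.1, le_rfl, ha.2⟩, ⟨ha.1, le_rfl, ha.2⟩⟩, by module⟩
      · rintro ⟨k, hk, a, b, ⟨⟨h1, h2, h3⟩, ⟨h4, h5, h6⟩⟩, rfl⟩
        obtain rfl : a = b := le_antisymm h5 h2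
        exact ⟨k, hk, a, ⟨h1, h3⟩, by module⟩
  have e₂ : φ (K + segBody (u + v) + segBody u) =
      φ T₁ + φ (translateBody u T₂) - φ (translateBody u (K + segBody v)) := by
    refine hφ.1.image f (K.isClosed.prod c₁) (K.isClosed.prod c₃) ?_ rfl ?_ ?_ ?_
    · rw [← prod_union, u₁₃]
      refine K.convex.prod ?_
      rintro ⟨x, y⟩ ⟨⟨h1, h2⟩, h3, h4⟩ ⟨x', y'⟩ ⟨⟨h1', h2'⟩, h3', h4'⟩ a b ha hb hab
      simp only at *
      refine ⟨⟨?_, ?_⟩, ?_, ?_⟩ <;> simp <;> nlinarith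
    · ext x
      rw [hmem, SetLike.mem_coe, mem_translateBody]
      constructor
      · rintro ⟨y, hy, rfl⟩
        obtain ⟨k, hk, a, b, ⟨h1, h2, h3⟩, rfl⟩ := (hmem _ _).1 hy
        simp only at h1 h2 h3
        exact ⟨k, hk, a + 1, b, ⟨by simpa using h1, by simpa using h2, h3⟩, by module⟩
      · rintro ⟨k, hk, a, b, ⟨h1, h2, h3⟩, rfl⟩
        simp only at h1 h2 h3
        exact ⟨k + (a - 1) • u + b • v, (hmem _ _).2 ⟨k, hk, a - 1, b,
          ⟨by simpa using h1, by simpa using h2, h3⟩, rfl⟩, by module⟩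
    · ext x
      rw [← prod_union, hmem, u₁₃, SetLike.mem_coe, mem_add_segBody]
      simp only [mem_add_segBody, mem_ofPred_eq]
      constructor
      · rintro ⟨_, ⟨k, hk, b, hb, rfl⟩, a, ha, rfl⟩
        exact ⟨k, hk, a + b, b, ⟨⟨by linarith, by linarith⟩, hb⟩, by module⟩
      · rintro ⟨k, hk, a, b, ⟨ha, hb⟩, rfl⟩
        exact ⟨_, ⟨k, hk, b, hb, rfl⟩, a - b, ⟨by linarith, by linarith⟩, by module⟩
    · ext x
      rw [prod_inter_prod, inter_self, hmem, SetLike.mem_coe, mem_translateBody]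
      simp only [mem_add_segBody]
      constructor
      · rintro ⟨_, ⟨k, hk, b, hb, rfl⟩, rfl⟩
        exact ⟨k, hk, 1, b, ⟨⟨hb.1, hb.2, le_rfl⟩, ⟨le_rfl, by simpa using hb.1, hb.2⟩⟩,
          by module⟩
      · rintro ⟨k, hk, a, b, ⟨⟨h1, h2, h3⟩, ⟨h4, h5, h6⟩⟩, rfl⟩
        obtain rfl : a = 1 := le_antisymm h3 h4
        exact ⟨_, ⟨k, hk, b, ⟨h1, h6⟩, rfl⟩, by module⟩
  rw [hφ.2.2.apply_translateBody, hφ.2.2.apply_translateBody] at e₂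
  simp only [segDiff, e₁, e₂]
  ring
lemma segDiff_const_mul {n : ℕ} (v : Euc n) (a : ℂ) (φ : CB n → ℂ) :
    segDiff v (fun K => a * φ K) = fun K => a * segDiff v φ K := by
  ext K
  simp only [segDiff, mul_sub]

lemma GoodVal.segDiff_add_smul_segDiff {n : ℕ} {φ : CB n → ℂ} (hφ : GoodVal φ) (u v : Euc n)
    (c : ℝ) : segDiff (c • u + v) (segDiff u φ) = segDiff v (segDiff u φ) := by
  have hpos : ∀ (v : Euc n) (c : ℝ), 0 < c →
      segDiff (c • u + v) (segDiff u φ) = segDiff v (segDiff u φ) := by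
    intro v c hc
    have h := hφ.segDiff_add_segDiff (c • u) v
    rw [hφ.segDiff_smul u hc.le, segDiff_const_mul, segDiff_const_mul] at h
    ext K
    exact mul_left_cancel₀ (Complex.ofReal_ne_zero.2 hc.ne') (congrFun h K)
  rcases lt_trichotomy c 0 with hc | rfl | hc
  · rw [← hpos (c • u + v) (-c) (neg_pos.2 hc)]
    congr 1
    module
  · simp
  · exact hpos v c hc

/-- Iterated differences along a list of segments. -/
def iterSegDiff {n : ℕ} (φ : CB n → ℂ) (l : List (Euc n)) : CB n → ℂ := l.foldr segDiff φ

lemma iterSegDiff_nil {n : ℕ} (φ : CB n → ℂ) : iterSegDiff φ [] = φ := rfl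

lemma iterSegDiff_cons {n : ℕ} (φ : CB n → ℂ) (v : Euc n) (l : List (Euc n)) :
    iterSegDiff φ (v :: l) = segDiff v (iterSegDiff φ l) := rfl

lemma iterSegDiff_segDiff {n : ℕ} (φ : CB n → ℂ) (v : Euc n) (l : List (Euc n)) :
    iterSegDiff (segDiff v φ) l = segDiff v (iterSegDiff φ l) := by
  induction l with
  | nil => rfl
  | cons w l ih => rw [iterSegDiff_cons, ih, segDiff_comm, iterSegDiff_cons]

lemma GoodVal.goodVal_iterSegDiff {n : ℕ} {φ : CB n → ℂ} (hφ : GoodVal φ) (l : List (Euc n)) :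
    GoodVal (iterSegDiff φ l) := by
  induction l with
  | nil => exact hφ
  | cons w l ih => exact ih.goodVal_segDiff w

lemma GoodVal.segDiff_iterSegDiff_of_mem_span {n : ℕ} {φ : CB n → ℂ} (hφ : GoodVal φ)
    (l : List (Euc n)) (w : Euc n) (hw : w ∈ Submodule.span ℝ {x | x ∈ l}) :
    segDiff w (iterSegDiff φ l) = 0 := by
  induction l generalizing w with
  | nil =>
    have : w = 0 := by simpa using hw
    rw [this, segDiff_zero_left]
  | cons v l ih =>
    have hset : {x | x ∈ v :: l} = insert v {x | x ∈ l} := by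
      ext x
      simp
    rw [hset] at hw
    obtain ⟨a, z, hz, rfl⟩ := Submodule.mem_span_insert.1 hw
    rw [iterSegDiff_cons, (hφ.goodVal_iterSegDiff l).segDiff_add_smul_segDiff, segDiff_comm,
      ih z hz, segDiff_zero_right]

lemma GoodVal.iterSegDiff_eq_zero_or_length_le {n : ℕ} {φ : CB n → ℂ} (hφ : GoodVal φ)
    (l : List (Euc n)) :
    iterSegDiff φ l = 0 ∨ l.length ≤ Module.finrank ℝ (Submodule.span ℝ {x | x ∈ l}) := by
  induction l with
  | nil => simp
  | cons v l ih =>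
    by_cases hv : v ∈ Submodule.span ℝ {x | x ∈ l}
    · exact Or.inl (hφ.segDiff_iterSegDiff_of_mem_span l v hv)
    · refine ih.imp (fun h => by rw [iterSegDiff_cons, h, segDiff_zero_right]) fun h => ?_
      have hlt : Submodule.span ℝ {x | x ∈ l} < Submodule.span ℝ {x | x ∈ v :: l} := by
        refine lt_of_le_of_ne (Submodule.span_mono fun x hx => List.mem_cons_of_mem v hx) ?_
        intro heq
        rw [heq] at hv
        exact hv (Submodule.subset_span (by simp))
      have := Submodule.finrank_lt_finrank_of_lt hlt
      simp only [List.length_cons]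
      omega

lemma GoodVal.iterSegDiff_eq_zero {n : ℕ} {φ : CB n → ℂ} (hφ : GoodVal φ)
    (l : List (Euc n)) (hl : l.length = n + 1) : iterSegDiff φ l = 0 := by
  refine (hφ.iterSegDiff_eq_zero_or_length_le l).resolve_right fun h => ?_
  have := Submodule.finrank_le (Submodule.span ℝ {x | x ∈ l})
  rw [finrank_euclideanSpace_fin] at this
  omega

/-- The zonotope generated by the segments from `0` to the entries of a list. -/
def zonotope {n : ℕ} (l : List (Euc n)) : CB n := (l.map segBody).sum

lemma zonotope_nil {n : ℕ} : zonotope ([] : List (Euc n)) = 0 := rfl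

lemma zonotope_cons {n : ℕ} (v : Euc n) (l : List (Euc n)) :
    zonotope (v :: l) = segBody v + zonotope l := by
  simp [zonotope]

open Polynomial in
lemma GoodVal.exists_polynomial_zonotope {n : ℕ} (l : List (Euc n)) {φ : CB n → ℂ}
    (hφ : GoodVal φ) {d : ℕ} (hd : ∀ m : List (Euc n), m.length = d → iterSegDiff φ m = 0)
    (K : CB n) : ∃ p : ℂ[X], (∀ m, d ≤ m → p.coeff m = 0) ∧
      ∀ ε : ℝ, 0 ≤ ε → φ (K + ε • zonotope l) = p.eval (ε : ℂ) := by
  induction l generalizing φ d with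
  | nil =>
    refine ⟨C (φ K), fun m hm => ?_, fun ε _ => by
      have h0 : ε • (0 : CB n) = 0 := ConvexBody.ext (smul_zero ε)
      rw [zonotope_nil, h0, add_zero, eval_C]⟩
    rcases m with _ | m
    · have := hd [] (by simp; omega)
      rw [iterSegDiff_nil] at this
      simp [this]
    · exact coeff_C_succ
  | cons v l ih =>
    rcases d with _ | d
    · have := hd [] rfl
      rw [iterSegDiff_nil] at this
      exact ⟨0, by simp, by simp [this]⟩
    · obtain ⟨p, hp, hpe⟩ := ih hφ hd
      obtain ⟨q, hq, hqe⟩ := ih (hφ.goodVal_segDiff v) (d := d) fun m hm => by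
        rw [iterSegDiff_segDiff, ← iterSegDiff_cons]
        exact hd _ (by simp [hm])
      refine ⟨p + X * q, fun m hm => ?_, fun ε hε => ?_⟩
      · obtain ⟨m, rfl⟩ : ∃ k, m = k + 1 := ⟨m - 1, by omega⟩
        rw [coeff_add, hp _ hm, coeff_X_mul, hq _ (by omega), add_zero]
      · rw [zonotope_cons, smul_add, smul_segBody, add_comm (segBody _), ← add_assoc,
          hφ.add_segBody_smul _ _ hε, hpe ε hε, hqe ε hε]
        simp

/-- Reconstruction of `φ (K + ε • Z)` from `n + 1` values by Lagrange interpolation. -/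
lemma GoodVal.eq_sum_basis_zonotope {n : ℕ} {φ : CB n → ℂ} (hφ : GoodVal φ) (K : CB n)
    (l : List (Euc n)) {ε : ℝ} (hε : 0 ≤ ε) :
    φ (K + ε • zonotope l) = ∑ i : Fin (n + 1), φ (K + (i : ℝ) • zonotope l) *
      (Lagrange.basis Finset.univ (fun i : Fin (n + 1) => ((i : ℕ) : ℂ)) i).eval (ε : ℂ) := by
  obtain ⟨p, hp, hpe⟩ := hφ.exists_polynomial_zonotope l hφ.iterSegDiff_eq_zero K
  have hinj : Set.InjOn (fun i : Fin (n + 1) => ((i : ℕ) : ℂ)) (Finset.univ : Finset (Fin (n + 1))) :=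
    fun i _ j _ h => Fin.ext (Nat.cast_injective h)
  have hdeg : p.degree < (Finset.univ : Finset (Fin (n + 1))).card := by
    rw [Finset.card_fin]
    exact (Polynomial.degree_lt_iff_coeff_zero _ _).2 hp
  have h := Lagrange.eq_interpolate hinj hdeg
  rw [hpe ε hε, h, Lagrange.interpolate_apply, Polynomial.eval_finsetSum]
  refine Finset.sum_congr rfl fun i _ => ?_
  rw [hpe i (by positivity)]
  simp

lemma dist_smul_body_le {n : ℕ} (c : ℝ) (K L : CB n) : dist (c • K) (c • L) ≤ |c| * dist K L := by
  have aux : ∀ r : ℝ, dist K L < r → dist (c • K) (c • L) ≤ |c| * r := by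
    intro r hr
    have aux : ∀ K L : CB n, dist K L < r → ∀ x ∈ c • K, ∃ y ∈ c • L, dist x y ≤ |c| * r := by
      rintro K L hr _ ⟨k, hk, rfl⟩
      obtain ⟨l, hl, hkl⟩ := exists_dist_lt hr hk
      refine ⟨c • l, ⟨l, hl, rfl⟩, ?_⟩
      simp only [dist_smul₀, Real.norm_eq_abs]
      gcongr
    exact dist_le_of_forall (mul_nonneg (abs_nonneg c) (dist_nonneg.trans hr.le))
      (aux K L hr) (aux L K (dist_comm K L ▸ hr))
  refine le_of_forall_pos_le_add fun η hη => ?_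
  have := aux (dist K L + η / (|c| + 1)) (by linarith [show 0 < η / (|c| + 1) by positivity])
  refine this.trans ?_
  rw [mul_add]
  gcongr
  rw [mul_div_assoc', div_le_iff₀ (by positivity)]
  nlinarith

lemma continuous_add_smul_body {n : ℕ} (K : CB n) (c : ℝ) :
    Continuous fun L : CB n => K + c • L := by
  refine (LipschitzWith.of_dist_le_mul (K := ‖c‖₊) fun L M => ?_).continuous
  rw [add_comm K, add_comm K, coe_nnnorm, Real.norm_eq_abs]
  exact (dist_add_right_body_le _ _ _).trans (dist_smul_body_le c L M)

lemma exists_dist_le_of_inner_le {n : ℕ} {L : CB n} {δ : ℝ} (hδ : 0 ≤ δ) {a : Euc n}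
    (h : ∀ u : Euc n, ∃ b ∈ L, inner ℝ u a ≤ inner ℝ u b + δ * ‖u‖) :
    ∃ b ∈ L, dist a b ≤ δ := by
  obtain ⟨p, hp, hmin⟩ := exists_norm_eq_iInf_of_complete_convex L.nonempty
    L.isClosed.isComplete L.convex a
  have hin := (norm_eq_iInf_iff_real_inner_le_zero L.convex hp).1 hmin
  refine ⟨p, hp, ?_⟩
  obtain ⟨b, hb, hab⟩ := h (a - p)
  have h₁ := hin b hb
  have h₂ := real_inner_self_eq_norm_sq (a - p)
  rw [inner_sub_right] at h₁ h₂
  rw [dist_eq_norm]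
  by_contra! hlt
  have : 0 ≤ ‖a - p‖ := norm_nonneg _
  rcases this.eq_or_lt with h0 | h0
  · linarith
  · nlinarith

/-- The value at `u` of the support function of the zonotope generated by a list. -/
def zonotopeSupport {n : ℕ} (l : List (Euc n)) (u : Euc n) : ℝ :=
  (l.map fun v => max 0 (inner ℝ u v)).sum

lemma inner_le_zonotopeSupport {n : ℕ} (l : List (Euc n)) (u : Euc n) :
    ∀ x ∈ zonotope l, inner ℝ u x ≤ zonotopeSupport l u := by
  induction l with
  | nil =>
    rintro x hx
    have : x = 0 := hx
    simp [this, zonotopeSupport]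
  | cons v l ih =>
    intro x hx
    rw [zonotope_cons] at hx
    obtain ⟨_, ⟨t, ht, rfl⟩, y, hy, rfl⟩ := hx
    have := ih y hy
    simp only [zonotopeSupport, List.map_cons, List.sum_cons] at this ⊢
    rw [inner_add_right, inner_smul_right]
    gcongr
    rcases le_total 0 (inner ℝ u v : ℝ) with h | h
    · exact le_max_of_le_right (mul_le_of_le_one_left h ht.2)
    · exact le_max_of_le_left (mul_nonpos_of_nonneg_of_nonpos ht.1 h)

lemma exists_inner_eq_zonotopeSupport {n : ℕ} (l : List (Euc n)) (u : Euc n) :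
    ∃ x ∈ zonotope l, inner ℝ u x = zonotopeSupport l u := by
  induction l with
  | nil => exact ⟨0, rfl, by simp [zonotopeSupport]⟩
  | cons v l ih =>
    obtain ⟨y, hy, hxy⟩ := ih
    rw [zonotope_cons]
    rcases le_total 0 (inner ℝ u v : ℝ) with h | h
    · refine ⟨v + y, ⟨v, ⟨1, by simp, by simp⟩, y, hy, rfl⟩, ?_⟩
      rw [inner_add_right, hxy]
      simp [zonotopeSupport, h]
    · refine ⟨0 + y, ⟨0, ⟨0, by simp, by simp⟩, y, hy, rfl⟩, ?_⟩
      rw [inner_add_right, hxy]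
      simp [zonotopeSupport, h]

lemma dist_zonotope_unitBallCB_le {n : ℕ} (l : List (Euc n)) {δ : ℝ} (hδ : 0 ≤ δ)
    (h : ∀ u : Euc n, |zonotopeSupport l u - ‖u‖| ≤ δ * ‖u‖) :
    dist (zonotope l) (unitBallCB n) ≤ δ := by
  refine dist_le_of_forall hδ (fun x hx => exists_dist_le_of_inner_le hδ fun u => ?_)
    fun x hx => exists_dist_le_of_inner_le hδ fun u => ?_
  · refine ⟨‖u‖⁻¹ • u, ?_, ?_⟩
    · change _ ∈ Metric.closedBall (0 : Euc n) 1
      rw [mem_closedBall_zero_iff, norm_smul, norm_inv, norm_norm]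
      exact inv_mul_le_one
    · rw [inner_smul_right, real_inner_self_eq_norm_sq]
      have h₁ := inner_le_zonotopeSupport l u x hx
      have h₂ := (abs_le.1 (h u)).2
      have h₃ : ‖u‖⁻¹ * ‖u‖ ^ 2 = ‖u‖ := by
        rcases eq_or_ne ‖u‖ 0 with h0 | h0
        · simp [h0]
        · field_simp
      linarith
  · obtain ⟨z, hz, hzu⟩ := exists_inner_eq_zonotopeSupport l u
    refine ⟨z, hz, ?_⟩
    have hx1 : ‖x‖ ≤ 1 := mem_closedBall_zero_iff.1 hx
    have h₁ := real_inner_le_norm u x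
    have h₂ := (abs_le.1 (h u)).1
    have : ‖u‖ * ‖x‖ ≤ ‖u‖ := mul_le_of_le_one_right (norm_nonneg _) hx1
    linarith

open MeasureTheory in
/-- The support function of the zonoid obtained by averaging segments over the unit ball is a
positive multiple of the norm. -/
lemma exists_integral_ball_inner_eq {n : ℕ} (hn : 1 ≤ n) : ∃ c : ℝ, 0 < c ∧ ∀ u : Euc n,
    ∫ x in Metric.closedBall (0 : Euc n) 1, max 0 (inner ℝ u x) = c * ‖u‖ := by
  obtain ⟨e, he⟩ : ∃ e : Euc n, ‖e‖ = 1 :=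
    ⟨EuclideanSpace.single ⟨0, hn⟩ 1, by simp⟩
  refine ⟨∫ x in Metric.closedBall (0 : Euc n) 1, max 0 (inner ℝ e x), ?_, fun u => ?_⟩
  · have hcont : Continuous fun x : Euc n => max 0 (inner ℝ e x : ℝ) := by fun_prop
    have hnonneg : ∀ x : Euc n, 0 ≤ max 0 (inner ℝ e x : ℝ) := fun x => le_max_left _ _
    rw [setIntegral_pos_iff_support_of_nonneg_ae (Eventually.of_forall hnonneg)
      (hcont.continuousOn.integrableOn_compact (isCompact_closedBall 0 1))]
    refine lt_of_lt_of_le (IsOpen.measure_pos volume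
      ((hcont.isOpen_support).inter (Metric.isOpen_ball (x := (0 : Euc n)) (ε := 1)))
      ⟨(1 / 2 : ℝ) • e, ?_, ?_⟩)
      (measure_mono (inter_subset_inter_right _ Metric.ball_subset_closedBall))
    · rw [Function.mem_support, inner_smul_right, real_inner_self_eq_norm_sq, he]
      norm_num
    · rw [mem_ball_zero_iff, norm_smul, he]
      norm_num
  · let R := (Submodule.span ℝ {u - ‖u‖ • e})ᗮ.reflection
    have hR : R u = ‖u‖ • e := Submodule.reflection_sub (by simp [norm_smul, he])
    have hball : R ⁻¹' Metric.closedBall (0 : Euc n) 1 = Metric.closedBall 0 1 := by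
      ext x
      simp
    have := R.measurePreserving.setIntegral_preimage_emb
      R.toHomeomorph.measurableEmbedding (fun x => max 0 (inner ℝ (‖u‖ • e) x : ℝ))
      (Metric.closedBall (0 : Euc n) 1)
    rw [hball] at this
    simp only [← hR, LinearIsometryEquiv.inner_map_map] at this
    rw [this, hR, mul_comm, ← integral_const_mul]
    refine integral_congr_ae (Eventually.of_forall fun x => ?_)
    simp only
    rw [real_inner_smul_left, mul_max_of_nonneg _ _ (norm_nonneg u), mul_zero]

lemma abs_max_inner_sub_le {n : ℕ} (u x y : Euc n) :
    |max 0 (inner ℝ u x) - max 0 (inner ℝ u y)| ≤ ‖u‖ * ‖x - y‖ := by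
  rw [max_comm 0, max_comm 0]
  refine (abs_max_sub_max_le_abs _ _ 0).trans ?_
  rw [← inner_sub_right]
  exact abs_real_inner_le_norm u (x - y)

open MeasureTheory in
lemma exists_zonotope_dist_le {n : ℕ} (hn : 1 ≤ n) {δ : ℝ} (hδ : 0 < δ) :
    ∃ l : List (Euc n), dist (zonotope l) (unitBallCB n) ≤ δ := by
  obtain ⟨c, hc, hcu⟩ := exists_integral_ball_inner_eq hn
  set μ : Measure (Euc n) := volume.restrict (Metric.closedBall (0 : Euc n) 1) with hμ
  have hfin : IsFiniteMeasure μ := ⟨by simpa [hμ] using measure_closedBall_lt_top⟩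
  have hid : Integrable (fun x : Euc n => x) μ :=
    continuous_id.continuousOn.integrableOn_compact (isCompact_closedBall 0 1)
  obtain ⟨s, hs, hsδ⟩ : ∃ s : SimpleFunc (Euc n) (Euc n), Integrable s μ ∧
      ∫ x, ‖s x - x‖ ∂μ < c * δ := by
    have h := tendsto_integral_norm_approxOn_sub (E := Euc n) (μ := μ) measurable_id hid
    obtain ⟨k, hk⟩ := ((tendsto_order.1 h).2 (c * δ) (by positivity)).exists
    exact ⟨_, SimpleFunc.integrable_approxOn_range measurable_id hid k, hk⟩
  refine ⟨s.range.toList.map fun v => (μ.real (s ⁻¹' {v}) / c) • v,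
    dist_zonotope_unitBallCB_le _ hδ.le fun u => ?_⟩
  have hsum : zonotopeSupport (s.range.toList.map fun v => (μ.real (s ⁻¹' {v}) / c) • v) u =
      (∫ x, max 0 (inner ℝ u (s x)) ∂μ) / c := by
    have h := SimpleFunc.map_integral s (fun v => max 0 (inner ℝ u v : ℝ)) hs (by simp)
    rw [SimpleFunc.integral_eq_integral _ (SimpleFunc.integrable_of_isFiniteMeasure _)] at h
    simp only [SimpleFunc.coe_map, Function.comp_def] at h
    rw [h, zonotopeSupport, List.map_map, Finset.sum_map_toList, Finset.sum_div]
    refine Finset.sum_congr rfl fun v _ => ?_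
    simp only [Function.comp_apply, smul_eq_mul]
    rw [inner_smul_right, ← mul_zero (μ.real (s ⁻¹' {v}) / c), ← mul_max_of_nonneg _ _
      (by positivity), mul_zero]
    ring
  have hintegrable : ∀ f : Euc n → Euc n, Integrable f μ →
      Integrable (fun x => max 0 (inner ℝ u (f x) : ℝ)) μ := fun f hf =>
    (integrable_zero _ _ _).sup (hf.const_inner u)
  have hnorm : ‖u‖ = (∫ x, max 0 (inner ℝ u x) ∂μ) / c := by
    rw [hcu u]
    field_simp
  rw [hsum]
  nth_rewrite 1 [hnorm]
  rw [← sub_div, ← integral_sub (hintegrable s hs) (hintegrable _ hid), abs_div, abs_of_pos hc,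
    div_le_iff₀ hc]
  have hdom : Integrable (fun x => ‖u‖ * ‖s x - x‖) μ := (hs.sub hid).norm.const_mul _
  rw [← Real.norm_eq_abs]
  calc ‖∫ x, max 0 (inner ℝ u (s x)) - max 0 (inner ℝ u x) ∂μ‖
      ≤ ∫ x, ‖u‖ * ‖s x - x‖ ∂μ :=
        norm_integral_le_of_norm_le hdom
          (Eventually.of_forall fun x => abs_max_inner_sub_le u (s x) x)
    _ = ‖u‖ * ∫ x, ‖s x - x‖ ∂μ := integral_const_mul _ _
    _ ≤ ‖u‖ * (c * δ) := by gcongr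
    _ = δ * ‖u‖ * c := by ring

/-- **McMullen**: for a translation invariant continuous convex valuation `φ` on `ℝⁿ` and a
convex body `K`, the function `ε ↦ φ(K + ε·D)` (`D` the closed unit ball, `+` the Minkowski
sum) is a polynomial in `ε ≥ 0` of degree at most `n`. -/
theorem mcmullen_polynomiality {n : ℕ} (hn : 1 ≤ n) (φ : CB n → ℂ) (hφ : GoodVal φ)
    (K : CB n) :
    ∃ c : Fin (n + 1) → ℂ, ∀ ε : ℝ, 0 ≤ ε →
      φ (K + ε • unitBallCB n) = ∑ j : Fin (n + 1), c j * (ε : ℂ) ^ (j : ℕ) := by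
  choose l hl using fun k : ℕ => exists_zonotope_dist_le hn (Nat.one_div_pos_of_nat (n := k))
  have hlim : Tendsto (fun k => zonotope (l k)) atTop (𝓝 (unitBallCB n)) :=
    tendsto_iff_dist_tendsto_zero.2 (squeeze_zero (fun _ => dist_nonneg) hl
      tendsto_one_div_add_atTop_nhds_zero_nat)
  have hlimφ : ∀ c : ℝ, Tendsto (fun k => φ (K + c • zonotope (l k))) atTop
      (𝓝 (φ (K + c • unitBallCB n))) := fun c =>
    ((hφ.2.1.comp (continuous_add_smul_body K c)).tendsto _).comp hlim
  let v : Fin (n + 1) → ℂ := fun i => ((i : ℕ) : ℂ)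
  let p := Lagrange.interpolate Finset.univ v fun i => φ (K + (i : ℝ) • unitBallCB n)
  have hdeg : p.degree < (n + 1 : ℕ) := by
    have := Lagrange.degree_interpolate_lt (s := Finset.univ) (v := v)
      (fun i => φ (K + (i : ℝ) • unitBallCB n))
      fun i _ j _ h => Fin.ext (Nat.cast_injective h)
    rwa [Finset.card_fin] at this
  refine ⟨fun j => p.coeff j, fun ε hε => ?_⟩
  have heval : φ (K + ε • unitBallCB n) = p.eval (ε : ℂ) := by
    refine tendsto_nhds_unique (hlimφ ε) ?_
    simp only [hφ.eq_sum_basis_zonotope K _ hε]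
    simp only [p, v, Lagrange.interpolate_apply, Polynomial.eval_finsetSum, Polynomial.eval_mul,
      Polynomial.eval_C]
    exact tendsto_finsetSum _ fun i _ => (hlimφ i).mul_const _
  have hnat : p.natDegree < n + 1 := by
    by_cases hp : p = 0
    · simp [hp]
    · exact (Polynomial.natDegree_lt_iff_degree_lt hp).2 hdeg
  rw [heval, Polynomial.eval_eq_sum_range' hnat]
  exact (Fin.sum_univ_eq_sum_range (fun j => p.coeff j * (ε : ℂ) ^ j) (n + 1)).symm
end
end

section
/- (Hadwiger) Let n ≥ 1. Every translation invariant continuous convex valuation φ on ℝⁿ that is invariant under the special orthogonal group SO(n) (i.e., φ(g(K)) = φ(K) for all g ∈ SO(n), K ∈ 𝒦(ℝⁿ)) is automatically invariant under the full orthogonal group O(n): φ(g(K)) = φ(K) for all g ∈ O(n) and K ∈ 𝒦(ℝⁿ). In other words, Val^{SO(n)}(ℝⁿ) = Val^{O(n)}(ℝⁿ). -/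
open scoped Pointwise

noncomputable section

section Dissection

variable {E : Type*} [NormedAddCommGroup E] [InnerProductSpace ℝ E]

/-- The orthogonal reflection in the hyperplane `⟪a, x⟫ = c`. -/
def hyperplaneReflection (a : E) (c : ℝ) (x : E) : E :=
  x - (2 * ((inner ℝ a x - c) / ‖a‖ ^ 2)) • a

/-- A set function which is additive under cutting compact convex sets by hyperplanes and
changes sign under reflections in hyperplanes. -/
structure IsReflectionOdd (μ : Set E → ℂ) : Prop where
  cut : ∀ (K : Set E), IsCompact K → Convex ℝ K → ∀ (a : E) (c : ℝ), a ≠ 0 →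
    μ K = μ (K ∩ {x | inner ℝ a x ≤ c}) + μ (K ∩ {x | c ≤ inner ℝ a x})
  refl : ∀ (K : Set E), IsCompact K → Convex ℝ K → ∀ (a : E) (c : ℝ), a ≠ 0 →
    μ (hyperplaneReflection a c '' K) = -μ K

/-- The region where the affine function with index `i` is maximal among those in `I`. -/
def maxRegion {ι : Type*} (I : Finset ι) (a : ι → E) (b : ι → ℝ) (i : ι) : Set E :=
  {x | ∀ j ∈ I, inner ℝ (a j) x - b j ≤ inner ℝ (a i) x - b i}

lemma isClosed_maxRegion {ι : Type*} (I : Finset ι) (a : ι → E) (b : ι → ℝ) (i : ι) :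
    IsClosed (maxRegion I a b i) := by
  simp only [maxRegion, Set.ofPred_forall]
  exact isClosed_biInter fun j _ => isClosed_le (by fun_prop) (by fun_prop)

lemma convex_setOf_inner_le (a : E) (c : ℝ) : Convex ℝ {x : E | inner ℝ a x ≤ c} :=
  convex_halfSpace_le (innerₛₗ ℝ a).isLinear c

lemma convex_maxRegion {ι : Type*} (I : Finset ι) (a : ι → E) (b : ι → ℝ) (i : ι) :
    Convex ℝ (maxRegion I a b i) := by
  have : maxRegion I a b i = ⋂ j ∈ I, {x | inner ℝ (a j - a i) x ≤ b j - b i} := by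
    ext x
    simp only [maxRegion, Set.mem_ofPred_eq, Set.mem_iInter, inner_sub_left]
    exact forall₂_congr fun j _ => by constructor <;> intro h <;> linarith
  rw [this]
  exact convex_iInter₂ fun j _ => convex_setOf_inner_le _ _

lemma IsReflectionOdd.eq_sum_maxRegion {μ : Set E → ℂ} (hμ : IsReflectionOdd μ) {ι : Type*}
    [DecidableEq ι] {I : Finset ι} (hI : I.Nonempty) (a : ι → E) (b : ι → ℝ)
    (ha : Set.InjOn a I) {K : Set E} (hK : IsCompact K) (hKc : Convex ℝ K) :
    μ K = ∑ i ∈ I, μ (K ∩ maxRegion I a b i) := by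
  induction hI using Finset.Nonempty.cons_induction generalizing K with
  | singleton i => simp [maxRegion]
  | cons k s hk hs ih =>
    have has : Set.InjOn a s := ha.mono (by simp)
    rw [Finset.sum_cons, ih has hK hKc, show K ∩ maxRegion (Finset.cons k s hk) a b k =
      K ∩ maxRegion s a b k by ext x; simp [maxRegion],
      ih has (hK.inter_right (isClosed_maxRegion s a b k)) (hKc.inter (convex_maxRegion s a b k)),
      ← Finset.sum_add_distrib]
    refine Finset.sum_congr rfl fun i hi => ?_
    have hne : a k - a i ≠ 0 := fun h =>
      hk (ha (by simp) (by simp [hi]) (sub_eq_zero.1 h) ▸ hi)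
    rw [hμ.cut _ (hK.inter_right (isClosed_maxRegion s a b i))
      (hKc.inter (convex_maxRegion s a b i)) _ (b k - b i) hne, add_comm]
    congr 2
    · ext x
      simp only [maxRegion, Set.mem_inter_iff, Set.mem_ofPred_eq, inner_sub_left]
      constructor
      · rintro ⟨⟨h1, h2⟩, h3⟩
        exact ⟨⟨h1, fun j hj => (h2 j hj).trans (by linarith)⟩, h2⟩
      · rintro ⟨⟨h1, h2⟩, h3⟩
        exact ⟨⟨h1, h3⟩, by linarith [h2 i hi]⟩
    · ext x
      simp only [maxRegion, Set.mem_inter_iff, Set.mem_ofPred_eq, inner_sub_left,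
        Finset.forall_mem_cons]
      constructor
      · rintro ⟨⟨h1, h2⟩, h3⟩
        exact ⟨h1, by linarith, h2⟩
      · rintro ⟨h1, h2, h3⟩
        exact ⟨⟨h1, h3⟩, by linarith⟩

/-- The polyhedron with outer normals `u ∈ U` and support numbers `b u`. -/
def polyhedron (U : Finset E) (b : E → ℝ) : Set E :=
  {x | ∀ u ∈ U, inner ℝ u x ≤ b u}

lemma isClosed_polyhedron (U : Finset E) (b : E → ℝ) : IsClosed (polyhedron U b) := by
  simp only [polyhedron, Set.ofPred_forall]
  exact isClosed_biInter fun j _ => isClosed_le (by fun_prop) (by fun_prop)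

lemma convex_polyhedron (U : Finset E) (b : E → ℝ) : Convex ℝ (polyhedron U b) := by
  simp only [polyhedron, Set.ofPred_forall]
  exact convex_iInter₂ fun j _ => convex_setOf_inner_le _ _

open Classical in
/-- The cell of a polyhedron consisting of the points whose nearest facet is `u` and for which the
normal to that facet, followed inwards, leaves the points nearest to `u` towards the facet `v`. -/
def polyhedronCell (U : Finset E) (b : E → ℝ) (u v : E) : Set E :=
  polyhedron U b ∩ maxRegion U id b u ∩
    maxRegion (U.erase u) (fun w => (‖w - u‖ ^ 2)⁻¹ • (w - u))
      (fun w => (‖w - u‖ ^ 2)⁻¹ * (b w - b u)) v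

lemma mem_polyhedronCell_iff {U : Finset E} {b : E → ℝ} {u v x : E} :
    x ∈ polyhedronCell U b u v ↔ (∀ w ∈ U, inner ℝ w x ≤ b w) ∧
      (∀ w ∈ U, inner ℝ w x - b w ≤ inner ℝ u x - b u) ∧
      ∀ w ∈ U, w ≠ u → (inner ℝ (w - u) x - (b w - b u)) / ‖w - u‖ ^ 2 ≤
        (inner ℝ (v - u) x - (b v - b u)) / ‖v - u‖ ^ 2 := by
  have (w : E) : inner ℝ ((‖w - u‖ ^ 2)⁻¹ • (w - u)) x - (‖w - u‖ ^ 2)⁻¹ * (b w - b u) =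
      (inner ℝ (w - u) x - (b w - b u)) / ‖w - u‖ ^ 2 := by
    rw [real_inner_smul_left]; ring
  simp only [polyhedronCell, maxRegion, polyhedron, this, Set.mem_inter_iff, Set.mem_ofPred_eq,
    Finset.mem_erase, id, and_assoc]
  tauto

lemma hyperplaneReflection_comm (a : E) (c : ℝ) :
    hyperplaneReflection (-a) (-c) = hyperplaneReflection a c := by
  ext x
  simp only [hyperplaneReflection, inner_neg_left, norm_neg, smul_neg]
  rw [← neg_smul]
  congr 2
  ring

lemma hyperplaneReflection_self {a : E} (ha : a ≠ 0) (c : ℝ) (x : E) :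
    hyperplaneReflection a c (hyperplaneReflection a c x) = x := by
  have : ‖a‖ ≠ 0 := norm_ne_zero_iff.2 ha
  simp only [hyperplaneReflection, inner_sub_right, inner_smul_right,
    real_inner_self_eq_norm_sq, sub_sub, ← add_smul]
  rw [sub_eq_self]
  convert zero_smul ℝ a
  field_simp
  ring

lemma image_hyperplaneReflection (a : E) (c : ℝ) (K : Set E) :
    hyperplaneReflection a c '' K =
      (fun x => (2 * c / ‖a‖ ^ 2) • a + x) '' ((ℝ ∙ a)ᗮ.reflection '' K) := by
  rw [Set.image_image]
  refine Set.image_congr fun x _ => ?_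
  rw [Submodule.reflection_orthogonal_apply, Submodule.reflection_singleton_apply,
    hyperplaneReflection, RCLike.ofReal_real_eq_id, id]
  module

lemma norm_sub_sq_of_unit {u v : E} (hu : ‖u‖ = 1) (hv : ‖v‖ = 1) :
    ‖u - v‖ ^ 2 = 2 - 2 * inner ℝ u v := by
  rw [norm_sub_sq_real, hu, hv]; ring

lemma hyperplaneReflection_mem_polyhedronCell {U : Finset E} (hU : ∀ u ∈ U, ‖u‖ = 1) (b : E → ℝ)
    {u v : E} (hu : u ∈ U) (hv : v ∈ U) (huv : v ≠ u) {x : E}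
    (hx : x ∈ polyhedronCell U b u v) :
    hyperplaneReflection (v - u) (b v - b u) x ∈ polyhedronCell U b v u := by
  rw [mem_polyhedronCell_iff] at hx
  obtain ⟨h1, h2, h3⟩ := hx
  have hpos {w z : E} (h : w ≠ z) : 0 < ‖w - z‖ ^ 2 :=
    pow_pos (norm_pos_iff.2 (sub_ne_zero.2 h)) 2
  obtain ⟨q, hq⟩ : ∃ q, q = (inner ℝ (v - u) x - (b v - b u)) / ‖v - u‖ ^ 2 := ⟨_, rfl⟩
  rw [← hq] at h3
  have hqv : inner ℝ v x - inner ℝ u x - (b v - b u) = q * (2 - 2 * inner ℝ v u) := by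
    rw [← norm_sub_sq_of_unit (hU v hv) (hU u hu), hq, div_mul_cancel₀ _ (hpos huv).ne',
      inner_sub_left]
  have hc : 0 < 2 - 2 * inner ℝ v u := by
    rw [← norm_sub_sq_of_unit (hU v hv) (hU u hu)]; exact hpos huv
  have hq0 : q ≤ 0 := by
    have := h2 v hv
    by_contra! h
    nlinarith [mul_pos h hc]
  have hk : ∀ w ∈ U, inner ℝ w x - inner ℝ u x - (b w - b u) ≤ q * (2 - 2 * inner ℝ w u) := by
    intro w hw
    by_cases hwu : w = u
    · subst hwu
      simp [hU w hw]
    · have := h3 w hw hwu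
      rwa [div_le_iff₀ (hpos hwu), norm_sub_sq_of_unit (hU w hw) (hU u hu), inner_sub_left] at this
  have hin (w : E) : inner ℝ w (hyperplaneReflection (v - u) (b v - b u) x) =
      inner ℝ w x - 2 * q * (inner ℝ w v - inner ℝ w u) := by
    simp only [hyperplaneReflection, inner_sub_right, inner_smul_right, ← hq]
  have hvv : inner ℝ v v = (1 : ℝ) := by simp [hU v hv]
  have huu : inner ℝ u u = (1 : ℝ) := by simp [hU u hu]
  have hswap : inner ℝ u v = (inner ℝ v u : ℝ) := real_inner_comm _ _
  have hgk : ∀ w ∈ U, inner ℝ w (hyperplaneReflection (v - u) (b v - b u) x) -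
      inner ℝ v (hyperplaneReflection (v - u) (b v - b u) x) - (b w - b v) ≤
        q * (2 - 2 * inner ℝ w v) := by
    intro w hw
    rw [hin, hin, hvv]
    linarith [hk w hw]
  have hgv : inner ℝ v (hyperplaneReflection (v - u) (b v - b u) x) - b v =
      inner ℝ u x - b u := by
    rw [hin, hvv]; linarith
  have hle : ∀ w ∈ U, q * (2 - 2 * inner ℝ w v) ≤ 0 := by
    intro w hw
    rw [← norm_sub_sq_of_unit (hU w hw) (hU v hv)]
    exact mul_nonpos_of_nonpos_of_nonneg hq0 (sq_nonneg _)
  rw [mem_polyhedronCell_iff]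
  refine ⟨fun w hw => ?_, fun w hw => ?_, fun w hw hwv => ?_⟩
  · linarith [hgk w hw, hle w hw, h1 u hu]
  · linarith [hgk w hw, hle w hw]
  · have : (inner ℝ (u - v) (hyperplaneReflection (v - u) (b v - b u) x) - (b u - b v)) /
        ‖u - v‖ ^ 2 = q := by
      rw [div_eq_iff (hpos huv.symm).ne', norm_sub_sq_of_unit (hU u hu) (hU v hv),
        inner_sub_left, hin, hin, hvv, huu, hswap]
      linarith
    rw [this, div_le_iff₀ (hpos hwv), norm_sub_sq_of_unit (hU w hw) (hU v hv), inner_sub_left]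
    exact hgk w hw

lemma image_polyhedronCell {U : Finset E} (hU : ∀ u ∈ U, ‖u‖ = 1) (b : E → ℝ)
    {u v : E} (hu : u ∈ U) (hv : v ∈ U) (huv : v ≠ u) :
    hyperplaneReflection (v - u) (b v - b u) '' polyhedronCell U b u v =
      polyhedronCell U b v u := by
  refine Set.Subset.antisymm (Set.image_subset_iff.2 fun x hx =>
    hyperplaneReflection_mem_polyhedronCell hU b hu hv huv hx) fun x hx => ?_
  refine ⟨_, hyperplaneReflection_mem_polyhedronCell hU b hv hu huv.symm hx, ?_⟩
  rw [← neg_sub v u, ← neg_sub (b v), hyperplaneReflection_comm,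
    hyperplaneReflection_self (sub_ne_zero.2 huv)]

lemma injective_inversion (u : E) :
    Function.Injective fun w : E => (‖w - u‖ ^ 2)⁻¹ • (w - u) := by
  have key (y : E) : ‖(‖y‖ ^ 2)⁻¹ • y‖ = ‖y‖⁻¹ := by
    rw [norm_smul, norm_inv, norm_pow, norm_norm]
    by_cases h : ‖y‖ = 0
    · simp [h]
    · field_simp
  intro w z h
  have hn : ‖w - u‖ = ‖z - u‖ := by
    have := congrArg norm h
    simpa only [key, inv_inj] using this
  simp only [hn] at h
  by_cases h0 : ‖z - u‖ = 0
  · have h1 := hn.trans h0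
    rw [norm_eq_zero, sub_eq_zero] at h0 h1
    rw [h0, h1]
  · exact sub_left_injective (smul_right_injective E (inv_ne_zero (pow_ne_zero 2 h0)) h)

theorem IsReflectionOdd.polyhedron_eq_zero {μ : Set E → ℂ} (hμ : IsReflectionOdd μ)
    {U : Finset E} (hU : ∀ u ∈ U, ‖u‖ = 1) (hne : U.Nontrivial) (b : E → ℝ)
    (hc : IsCompact (polyhedron U b)) : μ (polyhedron U b) = 0 := by
  classical
  have hcell : ∀ u ∈ U, μ (polyhedron U b ∩ maxRegion U id b u) =
      ∑ v ∈ U.erase u, μ (polyhedronCell U b u v) := fun u hu =>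
    hμ.eq_sum_maxRegion (hne.erase_nonempty) _ _ (injective_inversion u).injOn
      (hc.inter_right (isClosed_maxRegion _ _ _ _))
      ((convex_polyhedron U b).inter (convex_maxRegion _ _ _ _))
  have hodd : ∀ u ∈ U, ∀ v ∈ U.erase u,
      μ (polyhedronCell U b u v) = -μ (polyhedronCell U b v u) := by
    intro u hu v hv
    obtain ⟨hvu, hv⟩ := Finset.mem_erase.1 hv
    rw [← image_polyhedronCell hU b hu hv hvu, hμ.refl _ _ _ _ _ (sub_ne_zero.2 hvu), neg_neg]
    · exact (hc.inter_right (isClosed_maxRegion _ _ _ _)).inter_right (isClosed_maxRegion _ _ _ _)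
    · exact ((convex_polyhedron U b).inter (convex_maxRegion _ _ _ _)).inter
        (convex_maxRegion _ _ _ _)
  have hsum : μ (polyhedron U b) = ∑ u ∈ U, ∑ v ∈ U.erase u, μ (polyhedronCell U b u v) := by
    rw [hμ.eq_sum_maxRegion hne.nonempty id b Function.injective_id.injOn hc
      (convex_polyhedron U b)]
    exact Finset.sum_congr rfl hcell
  have hneg : μ (polyhedron U b) = -μ (polyhedron U b) := by
    conv_lhs => rw [hsum, Finset.sum_congr rfl fun u hu => Finset.sum_congr rfl (hodd u hu)]
    rw [hsum]
    simp only [Finset.sum_neg_distrib]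
    rw [Finset.sum_comm' (t' := U) (s' := fun v => U.erase v)]
    intro u v
    simp only [Finset.mem_erase]
    tauto
  exact self_eq_neg.1 hneg

end Dissection

section Approximation

lemma mem_cthickening_iff_infDist_le {X : Type*} [PseudoMetricSpace X] {K : Set X}
    (hne : K.Nonempty) {ε : ℝ} (hε : 0 ≤ ε) {x : X} :
    x ∈ Metric.cthickening ε K ↔ Metric.infDist x K ≤ ε := by
  rw [Metric.mem_cthickening_iff, Metric.infDist,
    ENNReal.le_ofReal_iff_toReal_le (Metric.infEDist_ne_top hne) hε]

variable {E : Type*} [NormedAddCommGroup E] [InnerProductSpace ℝ E]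

lemma exists_unit_inner_gt [CompleteSpace E] {K : Set E} (hK : IsCompact K) (hKc : Convex ℝ K)
    (hne : K.Nonempty) {y : E} (hy : y ∉ K) :
    ∃ v : E, ‖v‖ = 1 ∧ sSup (inner ℝ v '' K) < inner ℝ v y := by
  obtain ⟨f, c, hf, hfy⟩ := geometric_hahn_banach_closed_point hKc hK.isClosed hy
  set a := (InnerProductSpace.toDual ℝ E).symm f with ha
  have hfa (x : E) : inner ℝ a x = f x := by simp [ha]
  have ha0 : a ≠ 0 := by
    rintro h0
    obtain ⟨k, hk⟩ := hne
    have := hf k hk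
    rw [← hfa, h0, inner_zero_left] at this hfy
    linarith
  have hn : 0 < ‖a‖ := norm_pos_iff.2 ha0
  refine ⟨‖a‖⁻¹ • a, by rw [norm_smul, norm_inv, norm_norm, inv_mul_cancel₀ hn.ne'], ?_⟩
  refine lt_of_le_of_lt (b := ‖a‖⁻¹ * c) (csSup_le (hne.image _) ?_) ?_
  · rintro _ ⟨x, hx, rfl⟩
    rw [real_inner_smul_left, hfa]
    exact mul_le_mul_of_nonneg_left (hf x hx).le (inv_nonneg.2 hn.le)
  · rw [real_inner_smul_left, hfa]
    exact mul_lt_mul_of_pos_left hfy (inv_pos.2 hn)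

lemma exists_polyhedron_approx [FiniteDimensional ℝ E] [Nontrivial E] {K : Set E}
    (hK : IsCompact K) (hKc : Convex ℝ K) (hne : K.Nonempty) {ε : ℝ} (hε : 0 < ε) :
    ∃ (U : Finset E) (b : E → ℝ), (∀ u ∈ U, ‖u‖ = 1) ∧ U.Nontrivial ∧ K ⊆ polyhedron U b ∧
      polyhedron U b ⊆ Metric.cthickening ε K := by
  classical
  set b : E → ℝ := fun v => sSup (inner ℝ v '' K)
  have hsub (U : Finset E) : K ⊆ polyhedron U b := fun x hx u _ =>
    le_csSup (hK.image (by fun_prop)).bddAbove ⟨x, hx, rfl⟩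
  have hYc : IsCompact {y | Metric.infDist y K = ε} :=
    hK.cthickening (r := ε) |>.of_isClosed_subset
      (isClosed_eq (Metric.continuous_infDist_pt K) continuous_const)
      fun y hy => (mem_cthickening_iff_infDist_le hne hε.le).2 hy.le
  have hsep : ∀ y ∈ {y | Metric.infDist y K = ε}, ∃ v : E, ‖v‖ = 1 ∧ b v < inner ℝ v y := by
    intro y hy
    refine exists_unit_inner_gt hK hKc hne fun hyK => ?_
    have : Metric.infDist y K = ε := hy
    rw [Metric.infDist_zero_of_mem hyK] at this
    exact hε.ne this
  choose! v hv1 hv using hsep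
  obtain ⟨t, ht, hcov⟩ := hYc.elim_nhds_subcover (fun y => {x | b (v y) < inner ℝ (v y) x})
    fun y hy => (isOpen_lt continuous_const (by fun_prop)).mem_nhds (hv y hy)
  obtain ⟨e, he⟩ := exists_norm_eq E zero_le_one
  have hee : e ≠ -e := fun h => by
    have h2 : (2 : ℝ) • e = 0 := by rw [two_smul, ← eq_neg_iff_add_eq_zero, ← h]
    have : e = 0 := (smul_eq_zero.1 h2).resolve_left two_ne_zero
    simp [this] at he
  refine ⟨insert e (insert (-e) (t.image v)), b, ?_, ⟨e, by simp, -e, by simp, hee⟩, hsub _, ?_⟩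
  · simp only [Finset.mem_insert, Finset.mem_image]
    rintro u (rfl | rfl | ⟨y, hy, rfl⟩)
    · exact he
    · simpa using he
    · exact hv1 y (ht y hy)
  · intro x hx
    rw [mem_cthickening_iff_infDist_le hne hε.le]
    by_contra! hlt
    obtain ⟨k, hk⟩ := hne
    have hpc := (convex_polyhedron (insert e (insert (-e) (t.image v))) b).isPreconnected
    obtain ⟨y, hyP, hy⟩ := hpc.intermediate_value (hsub _ hk) hx
      (Metric.continuous_infDist_pt K).continuousOn
      ⟨by rw [Metric.infDist_zero_of_mem hk]; exact hε.le, hlt.le⟩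
    obtain ⟨z, hz, hzy⟩ := Set.mem_iUnion₂.1 (hcov hy)
    exact not_le.2 hzy (hyP (v z) (Finset.mem_insert_of_mem
      (Finset.mem_insert_of_mem (Finset.mem_image_of_mem v hz))))

end Approximation

section Valuation

variable {n : ℕ}

/-- The image of a convex body under a linear isometry. -/
def imageBody (g : Euc n ≃ₗᵢ[ℝ] Euc n) (K : CB n) : CB n where
  carrier := g '' K
  convex' := K.convex.linear_image (g.toLinearEquiv : Euc n →ₗ[ℝ] Euc n)
  isCompact' := K.isCompact.image g.continuous
  nonempty' := K.nonempty.image g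

@[simp]
lemma coe_imageBody (g : Euc n ≃ₗᵢ[ℝ] Euc n) (K : CB n) :
    (imageBody g K : Set (Euc n)) = g '' K := rfl

lemma continuous_imageBody (g : Euc n ≃ₗᵢ[ℝ] Euc n) : Continuous (imageBody g) := by
  refine Isometry.continuous (Isometry.of_dist_eq fun K L => ?_)
  rw [← ConvexBody.hausdorffDist_coe, ← ConvexBody.hausdorffDist_coe, coe_imageBody,
    coe_imageBody, Metric.hausdorffDist_image g.isometry]

open Classical in
/-- Extension of a function on convex bodies to all sets, by zero. -/
def extendByZero (ψ : CB n → ℂ) (S : Set (Euc n)) : ℂ :=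
  if h : Convex ℝ S ∧ IsCompact S ∧ S.Nonempty then ψ ⟨S, h.1, h.2.1, h.2.2⟩ else 0

lemma extendByZero_coe (ψ : CB n → ℂ) (K : CB n) : extendByZero ψ K = ψ K :=
  dif_pos ⟨K.convex, K.isCompact, K.nonempty⟩

lemma extendByZero_empty (ψ : CB n → ℂ) : extendByZero ψ ∅ = 0 :=
  dif_neg fun h => Set.not_nonempty_empty h.2.2

lemma isReflectionOdd_extendByZero {ψ : CB n → ℂ} (hval : IsVal ψ)
    (hrefl : ∀ (K L : CB n) (a : Euc n) (c : ℝ), a ≠ 0 →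
      (L : Set (Euc n)) = hyperplaneReflection a c '' K → ψ L = -ψ K) :
    IsReflectionOdd (extendByZero ψ) where
  cut K hK hKc a c ha := by
    have hA : IsClosed {x : Euc n | inner ℝ a x ≤ c} := isClosed_le (by fun_prop) (by fun_prop)
    have hB : IsClosed {x : Euc n | c ≤ inner ℝ a x} := isClosed_le (by fun_prop) (by fun_prop)
    have hBc : Convex ℝ {x : Euc n | c ≤ inner ℝ a x} :=
      convex_halfSpace_ge (innerₛₗ ℝ a).isLinear c
    have hAB : K = (K ∩ {x | inner ℝ a x ≤ c}) ∪ (K ∩ {x | c ≤ inner ℝ a x}) := by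
      ext x
      have := le_total (inner ℝ a x) c
      simp only [Set.mem_union, Set.mem_inter_iff, Set.mem_ofPred_eq]
      tauto
    rcases (K ∩ {x | inner ℝ a x ≤ c}).eq_empty_or_nonempty with hAe | hAn
    · rw [hAe, Set.empty_union] at hAB
      rw [hAe, extendByZero_empty, zero_add, ← hAB]
    rcases (K ∩ {x | c ≤ inner ℝ a x}).eq_empty_or_nonempty with hBe | hBn
    · rw [hBe, Set.union_empty] at hAB
      rw [hBe, extendByZero_empty, add_zero, ← hAB]
    have hIn := isPreconnected_closed_iff.1 hKc.isPreconnected _ _ hA hB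
      (fun x _ => le_total (inner ℝ a x) c) hAn hBn
    let A : CB n := ⟨_, hKc.inter (convex_setOf_inner_le a c), hK.inter_right hA, hAn⟩
    let B : CB n := ⟨_, hKc.inter hBc, hK.inter_right hB, hBn⟩
    let U : CB n := ⟨K, hKc, hK, hAn.left⟩
    let I : CB n := ⟨_, hKc.inter ((convex_setOf_inner_le a c).inter hBc),
      hK.inter_right (hA.inter hB), hIn⟩
    have hfix : ∀ x ∈ (I : Set (Euc n)), hyperplaneReflection a c x = x := by
      rintro x ⟨-, h1, h2⟩
      have : inner ℝ a x = c := le_antisymm h1 h2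
      simp [hyperplaneReflection, this]
    have hI : ψ I = 0 := by
      refine self_eq_neg.1 (hrefl I I a c ha ?_)
      rw [Set.image_congr hfix, Set.image_id']
    have hU := hval A B U I hAB (Set.inter_inter_distrib_left _ _ _)
    rw [hI, sub_zero] at hU
    have := extendByZero_coe ψ U
    rw [hU, ← extendByZero_coe ψ A, ← extendByZero_coe ψ B] at this
    exact this
  refl K hK hKc a c ha := by
    rcases K.eq_empty_or_nonempty with rfl | hne
    · simp [extendByZero_empty]
    let K' : CB n := ⟨K, hKc, hK, hne⟩
    let L : CB n := ⟨hyperplaneReflection a c '' K, by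
      rw [image_hyperplaneReflection]
      exact (hKc.linear_image
        ((ℝ ∙ a)ᗮ.reflection.toLinearEquiv : Euc n →ₗ[ℝ] Euc n)).translate _, by
      rw [image_hyperplaneReflection]
      exact (hK.image (LinearIsometryEquiv.continuous _)).image (by fun_prop), hne.image _⟩
    have := hrefl K' L a c ha rfl
    rw [← extendByZero_coe ψ K', ← extendByZero_coe ψ L] at this
    exact this

theorem eq_zero_of_reflection_odd (hn : 1 ≤ n) {ψ : CB n → ℂ} (hval : IsVal ψ)
    (hcont : Continuous ψ)
    (hrefl : ∀ (K L : CB n) (a : Euc n) (c : ℝ), a ≠ 0 →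
      (L : Set (Euc n)) = hyperplaneReflection a c '' K → ψ L = -ψ K) (K : CB n) : ψ K = 0 := by
  have : Nonempty (Fin n) := ⟨⟨0, hn⟩⟩
  have hclosed : IsClosed {L : CB n | ψ L = 0} := isClosed_eq hcont continuous_const
  refine hclosed.closure_subset (Metric.mem_closure_iff.2 fun ε hε => ?_)
  obtain ⟨U, b, hU, hUn, hKU, hUK⟩ :=
    exists_polyhedron_approx K.isCompact K.convex K.nonempty (half_pos hε)
  have hc : IsCompact (polyhedron U b) :=
    K.isCompact.cthickening.of_isClosed_subset (isClosed_polyhedron U b) hUK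
  let P : CB n := ⟨polyhedron U b, convex_polyhedron U b, hc, K.nonempty.mono hKU⟩
  refine ⟨P, ?_, ?_⟩
  · exact (extendByZero_coe ψ P).symm.trans
      ((isReflectionOdd_extendByZero hval hrefl).polyhedron_eq_zero hU hUn b hc)
  · rw [← ConvexBody.hausdorffDist_coe]
    refine lt_of_le_of_lt (Metric.hausdorffDist_le_of_infDist (half_pos hε).le
      (fun x hx => ?_) fun x hx => ?_) (half_lt_self hε)
    · exact (Metric.infDist_zero_of_mem (hKU hx)).trans_le (half_pos hε).le
    · exact (mem_cthickening_iff_infDist_le K.nonempty (half_pos hε).le).1 (hUK hx)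

lemma det_eq_one_or_neg_one (g : Euc n ≃ₗᵢ[ℝ] Euc n) :
    LinearMap.det (g.toLinearEquiv : Euc n →ₗ[ℝ] Euc n) = 1 ∨
      LinearMap.det (g.toLinearEquiv : Euc n →ₗ[ℝ] Euc n) = -1 := by
  have h := LinearMap.normDet_eq_abs_det (g.toLinearEquiv : Euc n →ₗ[ℝ] Euc n)
  have h1 : (g.toLinearEquiv : Euc n →ₗ[ℝ] Euc n).normDet = 1 :=
    g.toLinearIsometry.normDet_eq_one
  rw [h1] at h
  exact eq_or_eq_neg_of_abs_eq h.symm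

lemma det_reflection_orthogonal_singleton {a : Euc n} (ha : a ≠ 0) :
    LinearMap.det ((ℝ ∙ a)ᗮ.reflection.toLinearEquiv : Euc n →ₗ[ℝ] Euc n) = -1 := by
  have := (ℝ ∙ a)ᗮ.det_reflection
  rw [Submodule.orthogonal_orthogonal, finrank_span_singleton ha, pow_one] at this
  exact this

end Valuation

/-- **Hadwiger**: every translation invariant continuous convex valuation on `ℝⁿ` invariant
under `SO(n)` (the linear isometries of determinant `1`) is automatically invariant under the
full orthogonal group `O(n)` (all linear isometries): `Val^{SO(n)}(ℝⁿ) = Val^{O(n)}(ℝⁿ)`. -/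
theorem so_invariant_implies_o_invariant {n : ℕ} (hn : 1 ≤ n) (φ : CB n → ℂ)
    (hφ : GoodVal φ)
    (hSO : ∀ g : Euc n ≃ₗᵢ[ℝ] Euc n,
      LinearMap.det (g.toLinearEquiv : Euc n →ₗ[ℝ] Euc n) = 1 →
      ∀ K L : CB n, (L : Set (Euc n)) = ⇑g '' (K : Set (Euc n)) → φ L = φ K) :
    ∀ g : Euc n ≃ₗᵢ[ℝ] Euc n,
      ∀ K L : CB n, (L : Set (Euc n)) = ⇑g '' (K : Set (Euc n)) → φ L = φ K := by
  intro g K L hL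
  rcases det_eq_one_or_neg_one g with hg | hg
  · exact hSO g hg K L hL
  obtain ⟨hval, hcont, htrans⟩ := hφ
  have hdet (r : Euc n ≃ₗᵢ[ℝ] Euc n)
      (hr : LinearMap.det (r.toLinearEquiv : Euc n →ₗ[ℝ] Euc n) = -1) (K : CB n) :
      φ (imageBody r K) = φ (imageBody g K) := by
    refine hSO (g.symm.trans r) ?_ _ _ ?_
    · have hinv : LinearMap.det (g.symm.toLinearEquiv : Euc n →ₗ[ℝ] Euc n) *
          LinearMap.det (g.toLinearEquiv : Euc n →ₗ[ℝ] Euc n) = 1 :=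
        LinearEquiv.det_symm_mul_det g.toLinearEquiv
      have hcomp : ((g.symm.trans r).toLinearEquiv : Euc n →ₗ[ℝ] Euc n) =
          (r.toLinearEquiv : Euc n →ₗ[ℝ] Euc n) ∘ₗ
            (g.symm.toLinearEquiv : Euc n →ₗ[ℝ] Euc n) := rfl
      rw [hg] at hinv
      rw [hcomp, LinearMap.det_comp, hr]
      linarith
    · simp [Set.image_image]
  have hzero := eq_zero_of_reflection_odd hn (ψ := fun K => φ K - φ (imageBody g K))
    (fun A B U I hU hI => ?_) (hcont.sub (hcont.comp (continuous_imageBody g)))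
    (fun K L a c ha hKL => ?_) K
  · rw [show L = imageBody g K from ConvexBody.ext hL]
    exact (sub_eq_zero.1 hzero).symm
  · have := hval (imageBody g A) (imageBody g B) (imageBody g U) (imageBody g I)
      (by simp [hU, Set.image_union]) (by simp [hI, Set.image_inter g.injective])
    simp only [hval A B U I hU hI, this]
    ring
  · set r := (ℝ ∙ a)ᗮ.reflection
    have hr := hdet r (det_reflection_orthogonal_singleton ha)
    have hL : φ L = φ (imageBody r K) := by
      refine htrans _ _ ((2 * c / ‖a‖ ^ 2) • a) ?_
      rw [hKL, image_hyperplaneReflection, coe_imageBody]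
      rfl
    have hgL : φ (imageBody g L) = φ K := by
      rw [← hr]
      refine htrans _ _ (r ((2 * c / ‖a‖ ^ 2) • a)) ?_
      rw [coe_imageBody, hKL, image_hyperplaneReflection, Set.image_image, Set.image_image]
      change _ = (fun x => r ((2 * c / ‖a‖ ^ 2) • a) + x) '' (K : Set (Euc n))
      refine Set.image_congr fun x _ => ?_
      rw [map_add, Submodule.reflection_reflection]
    simp only [hL, hgL, hr]
    ring
end
end
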